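/- arXiv:1410.4480 — 11 statements merged into one kernel-verified Lean document; each statement's English description precedes it below -/
import Mathlib

section
/- Let P, Q : ℝ² → ℝ be continuous functions, let f : ℝ² → ℝ be of class C¹, and let k : ℝ² → ℝ be continuous, and suppose that P(x,y)·∂f/∂x(x,y) + Q(x,y)·∂f/∂y(x,y) = k(x,y)·f(x,y) for all (x,y) ∈ ℝ². Let γ : ℝ → ℝ² be a differentiable function with γ'(t) = (P(γ(t)), Q(γ(t))) for all t, let T > 0 satisfy γ(t+T) = γ(t) for all t, and suppose f(γ(t)) > 0 for all t. Then ∫₀ᵀ k(γ(t)) dt = 0. -/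
/-- If `f = 0` is an invariant curve with cofactor `k` of the planar system
`ẋ = P(x,y), ẏ = Q(x,y)`, and `γ` is a `T`-periodic solution along which `f > 0`,
then the integral of the cofactor over one period vanishes. -/
theorem cofactor_integral_eq_zero
    (P Q k f : ℝ × ℝ → ℝ)
    (hP : Continuous P) (hQ : Continuous Q) (hk : Continuous k)
    (hf : ContDiff ℝ 1 f)
    (hinv : ∀ p : ℝ × ℝ,
      P p * fderiv ℝ f p (1, 0) + Q p * fderiv ℝ f p (0, 1) = k p * f p)
    (γ : ℝ → ℝ × ℝ)
    (hγ : ∀ t : ℝ, HasDerivAt γ (P (γ t), Q (γ t)) t)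
    (T : ℝ) (hT : 0 < T)
    (hper : ∀ t : ℝ, γ (t + T) = γ t)
    (hpos : ∀ t : ℝ, 0 < f (γ t)) :
    ∫ t in (0:ℝ)..T, k (γ t) = 0 := by
  have hderiv : ∀ t : ℝ, HasDerivAt (fun t => Real.log (f (γ t))) (k (γ t)) t := by
    intro t
    have hfγ := ((hf.differentiable one_ne_zero (γ t)).hasFDerivAt.comp_hasDerivAt t (hγ t)).log
      (hpos t).ne'
    have hsplit : (P (γ t), Q (γ t)) =
        P (γ t) • ((1, 0) : ℝ × ℝ) + Q (γ t) • ((0, 1) : ℝ × ℝ) := by simp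
    have hval : fderiv ℝ f (γ t) (P (γ t), Q (γ t)) / f (γ t) = k (γ t) := by
      rw [div_eq_iff (hpos t).ne', hsplit, map_add, map_smul, map_smul]
      exact hinv (γ t)
    exact hval ▸ hfγ
  have hγc : Continuous γ := continuous_iff_continuousAt.2 fun t => (hγ t).continuousAt
  rw [intervalIntegral.integral_eq_sub_of_hasDerivAt (fun t _ => hderiv t)
    ((hk.comp hγc).intervalIntegrable 0 T)]
  have h := hper 0
  rw [zero_add] at h
  simp [h]
end

section
/- Let γ = (γ₁, γ₂) : ℝ → ℝ² be a differentiable function with γ₁'(t) = γ₁(t) + γ₁(t)² − γ₂(t) and γ₂'(t) = γ₁(t)(1 + γ₁(t) + γ₂(t)) for all t, let T > 0 satisfy γ(t+T) = γ(t) for all t, and suppose that 1 − γ₁(t)² + 2γ₂(t) ≠ 0 for all t. Then ∫₀ᵀ (1 + 3γ₁(t)) dt = T; in particular, the integral of the divergence of the system along any such periodic solution equals T > 0. -/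
/-- The integral of the cofactor of a nonvanishing function with equal end values is zero. -/
theorem integral_cofactor_eq_zero {u k : ℝ → ℝ} {a b : ℝ}
    (hu : ∀ t, HasDerivAt u (k t * u t) t) (hne : ∀ t, u t ≠ 0)
    (hk : IntervalIntegrable k MeasureTheory.volume a b) (hab : u b = u a) :
    ∫ t in a..b, k t = 0 := by
  have hlog : ∀ t, HasDerivAt (fun s => Real.log (u s)) (k t) t := fun t => by
    simpa [hne t] using (hu t).log (hne t)
  rw [intervalIntegral.integral_eq_sub_of_hasDerivAt (fun t _ => hlog t) hk, hab, sub_self]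

/-- Along any `T`-periodic solution of `ẋ = x + x² - y, ẏ = x(1+x+y)` avoiding the
invariant parabola `1 - x² + 2y = 0`, the integral of the divergence `1 + 3x`
over one period equals `T`. -/
theorem integral_divergence_eq_period
    (γ₁ γ₂ : ℝ → ℝ)
    (h1 : ∀ t : ℝ, HasDerivAt γ₁ (γ₁ t + (γ₁ t) ^ 2 - γ₂ t) t)
    (h2 : ∀ t : ℝ, HasDerivAt γ₂ (γ₁ t * (1 + γ₁ t + γ₂ t)) t)
    (T : ℝ) (hT : 0 < T)
    (hper : ∀ t : ℝ, γ₁ (t + T) = γ₁ t ∧ γ₂ (t + T) = γ₂ t)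
    (hpar : ∀ t : ℝ, 1 - (γ₁ t) ^ 2 + 2 * γ₂ t ≠ 0) :
    ∫ t in (0:ℝ)..T, (1 + 3 * γ₁ t) = T := by
  have hc : Continuous γ₁ := continuous_iff_continuousAt.2 fun t => (h1 t).continuousAt
  have hu : ∀ t, HasDerivAt (fun s => 1 - (γ₁ s) ^ 2 + 2 * γ₂ s)
      (2 * γ₁ t * (1 - (γ₁ t) ^ 2 + 2 * γ₂ t)) t := fun t => by
    refine ((((h1 t).pow 2).const_sub 1).add ((h2 t).const_mul 2)).congr_deriv ?_
    ring
  obtain ⟨hx, hy⟩ := hper 0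
  rw [zero_add] at hx hy
  have hzero : ∫ t in (0:ℝ)..T, 2 * γ₁ t = 0 :=
    integral_cofactor_eq_zero hu hpar ((continuous_const.mul hc).intervalIntegrable _ _)
      (by simp only [hx, hy])
  rw [intervalIntegral.integral_const_mul] at hzero
  rw [intervalIntegral.integral_add intervalIntegrable_const
      ((hc.intervalIntegrable _ _).const_mul 3), intervalIntegral.integral_const_mul,
    intervalIntegral.integral_const, smul_eq_mul]
  linarith
end

section
/- The planar polynomial system ẋ = x + x² − y, ẏ = x(1 + x + y) has no nonconstant periodic solution; that is, there is no differentiable γ : ℝ → ℝ², nonconstant, with γ'(t) = (γ₁(t) + γ₁(t)² − γ₂(t), γ₁(t)(1 + γ₁(t) + γ₂(t))) for all t and γ(t+T) = γ(t) for all t for some T > 0. In particular, for δ = 1 the limit cycle of the system ẋ = δx + x² − y, ẏ = x(1+x+y) has disappeared. -/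
/-- A periodic function with nonnegative derivative has zero derivative. -/
theorem Function.Periodic.eq_zero_of_hasDerivAt_nonneg {f f' : ℝ → ℝ} {T : ℝ}
    (hper : Function.Periodic f T) (hT : 0 < T) (hf : ∀ t, HasDerivAt f (f' t) t)
    (hf' : ∀ t, 0 ≤ f' t) (t : ℝ) : f' t = 0 := by
  have hmono : Monotone f :=
    monotone_of_deriv_nonneg (fun t => (hf t).differentiableAt) fun t => by
      rw [(hf t).deriv]; exact hf' t
  have hconst : ∀ a b, f a ≤ f b := fun a b => by
    obtain ⟨n, hn⟩ := exists_nat_ge ((a - b) / T)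
    rw [div_le_iff₀ hT] at hn
    calc f a ≤ f (b + n * T) := hmono (by linarith)
      _ = f b := hper.nat_mul n b
  have hf0 : f = fun _ => f 0 := funext fun s => le_antisymm (hconst s 0) (hconst 0 s)
  have h := hf t
  rw [hf0] at h
  exact h.unique (hasDerivAt_const t (f 0))

/-- A solution of a scalar linear equation `m' = a m` with continuous coefficient is a positive
multiple of its initial value at every time. -/
theorem exists_pos_eq_mul_of_hasDerivAt_mul {a m : ℝ → ℝ} (ha : Continuous a)
    (hm : ∀ t, HasDerivAt m (a t * m t) t) (t : ℝ) : ∃ c, 0 < c ∧ m t = c * m 0 := by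
  let A : ℝ → ℝ := fun t => ∫ s in (0 : ℝ)..t, a s
  have hA : ∀ t, HasDerivAt A (a t) t := fun t => ha.integral_hasStrictDerivAt 0 t |>.hasDerivAt
  have hG : ∀ t, HasDerivAt (fun t => m t * Real.exp (-A t)) 0 t := fun t => by
    refine ((hm t).mul (hA t).neg.exp).congr_deriv ?_
    simp only [Pi.neg_apply]
    ring
  have h := is_const_of_deriv_eq_zero (fun t => (hG t).differentiableAt)
    (fun t => (hG t).deriv) t 0
  have hA0 : A 0 = 0 := intervalIntegral.integral_same
  simp only [hA0, neg_zero, Real.exp_zero, mul_one] at h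
  refine ⟨Real.exp (A t), Real.exp_pos _, ?_⟩
  rw [← h, mul_left_comm, ← Real.exp_add, add_neg_cancel, Real.exp_zero, mul_one]

/-- The system `ẋ = x + x² - y, ẏ = x(1 + x + y)` (the quadratic system with `δ = 1`)
has no nonconstant periodic solution: the limit cycle has disappeared. -/
theorem no_periodic_orbit_delta_one :
    ¬ ∃ (γ : ℝ → ℝ × ℝ) (T : ℝ), 0 < T ∧
      (∀ t : ℝ, HasDerivAt γ
        ((γ t).1 + (γ t).1 ^ 2 - (γ t).2, (γ t).1 * (1 + (γ t).1 + (γ t).2)) t) ∧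
      (∀ t : ℝ, γ (t + T) = γ t) ∧
      (∃ t₁ t₂ : ℝ, γ t₁ ≠ γ t₂) := by
  rintro ⟨γ, T, hT, hγ, hper, t₁, t₂, hne⟩
  obtain ⟨x, hx_def⟩ : ∃ x : ℝ → ℝ, ∀ t, x t = (γ t).1 := ⟨_, fun _ => rfl⟩
  obtain ⟨y, hy_def⟩ : ∃ y : ℝ → ℝ, ∀ t, y t = (γ t).2 := ⟨_, fun _ => rfl⟩
  have hx : ∀ t, HasDerivAt x (x t + x t ^ 2 - y t) t := fun t => by
    rw [hx_def t, hy_def t, funext hx_def]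
    exact (hasFDerivAt_fst (𝕜 := ℝ) (p := γ t)).comp_hasDerivAt t (hγ t)
  have hy : ∀ t, HasDerivAt y (x t * (1 + x t + y t)) t := fun t => by
    rw [hx_def t, hy_def t, funext hy_def]
    exact (hasFDerivAt_snd (𝕜 := ℝ) (p := γ t)).comp_hasDerivAt t (hγ t)
  have hxper : Function.Periodic x T := fun t => by rw [hx_def, hx_def, hper]
  have hyper : Function.Periodic y T := fun t => by rw [hy_def, hy_def, hper]
  -- The parabola `1 + 2y - x² = 0` is invariant.
  obtain ⟨m, hm_def⟩ : ∃ m : ℝ → ℝ, ∀ t, m t = 1 + 2 * y t - x t ^ 2 := ⟨_, fun _ => rfl⟩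
  have hm : ∀ t, HasDerivAt m (2 * x t * m t) t := fun t => by
    rw [hm_def t, funext hm_def]
    refine ((((hy t).const_mul 2).const_add 1).sub ((hx t).pow 2)).congr_deriv ?_
    push_cast
    ring
  have hxc : Continuous x := continuous_iff_continuousAt.2 fun t => (hx t).continuousAt
  have hsign := exists_pos_eq_mul_of_hasDerivAt_mul (hxc.const_mul 2) hm
  have hnot : ¬ ∃ p : ℝ × ℝ, ∀ t, x t = p.1 ∧ y t = p.2 := by
    rintro ⟨p, hp⟩
    refine hne (Prod.ext ?_ ?_)
    · rw [← hx_def, ← hx_def, (hp t₁).1, (hp t₂).1]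
    · rw [← hy_def, ← hy_def, (hp t₁).2, (hp t₂).2]
  rcases le_or_gt (m 0) 0 with h0 | h0
  · have hmle : ∀ t, m t ≤ 0 := fun t => by
      obtain ⟨c, hc, h⟩ := hsign t
      rw [h]
      exact mul_nonpos_of_nonneg_of_nonpos hc.le h0
    have hz := hxper.eq_zero_of_hasDerivAt_nonneg hT hx fun t => by
      nlinarith [hmle t, hm_def t, sq_nonneg (x t + 1)]
    refine hnot ⟨(-1, 0), fun t => ?_⟩
    have hxt : x t = -1 := by
      have : (x t + 1) ^ 2 = 0 :=
        le_antisymm (by nlinarith [hmle t, hm_def t, hz t]) (sq_nonneg _)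
      linarith [pow_eq_zero_iff two_ne_zero |>.1 this]
    have hyt := hz t
    rw [hxt] at hyt
    exact ⟨hxt, by linarith⟩
  · have hmpos : ∀ t, 0 < m t := fun t => by
      obtain ⟨c, hc, h⟩ := hsign t
      rw [h]
      exact mul_pos hc h0
    -- `(x² + 1 + m)² / m` is a strict Lyapunov function on the region `m > 0`.
    have hU : ∀ t, HasDerivAt (fun t => (x t ^ 2 + 1 + m t) ^ 2 / m t)
        (4 * x t ^ 2 * (x t ^ 2 + 1 + m t) / m t) t := fun t => by
      have hne := (hmpos t).ne'
      refine ((((((hx t).pow 2).add_const 1).add (hm t)).pow 2).div (hm t) hne).congr_deriv ?_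
      have hyt : y t = (m t - 1 + x t ^ 2) / 2 := by linarith [hm_def t]
      simp only [Pi.add_apply, Pi.pow_apply]
      rw [hyt]
      field_simp
      push_cast
      ring
    have hmper : Function.Periodic m T := fun t => by
      rw [hm_def, hm_def, hxper t, hyper t]
    have hz := Function.Periodic.eq_zero_of_hasDerivAt_nonneg
      (fun t => by simp only [hxper t, hmper t]) hT hU fun t => by
        have := hmpos t
        positivity
    have hx0 : ∀ t, x t = 0 := fun t => by
      have := hmpos t
      have hpos : 0 < x t ^ 2 + 1 + m t := by positivity
      simpa [hpos.ne', this.ne'] using hz t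
    refine hnot ⟨(0, 0), fun t => ⟨hx0 t, ?_⟩⟩
    have h := hx t
    rw [funext hx0] at h
    have := h.unique (hasDerivAt_const t (0 : ℝ))
    norm_num at this
    exact this
end

section
/- For each δ ∈ (0,1), the quadratic system ẋ = δx + x² − y, ẏ = x(1 + x + y) has at least one nonconstant periodic solution: there exist a nonconstant differentiable γ : ℝ → ℝ² and T > 0 with γ'(t) = (δγ₁(t) + γ₁(t)² − γ₂(t), γ₁(t)(1 + γ₁(t) + γ₂(t))) and γ(t+T) = γ(t) for all t. -/
open Set

theorem exists_periodic_boundary_solution {G : ℝ → ℝ → ℝ} {K L : NNReal} {p a b : ℝ}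
    (hp : 0 < p) (hab : a ≤ b) (hK : ∀ t, LipschitzWith K (G t)) (hL : ∀ t x, ‖G t x‖ ≤ L)
    (hc : ∀ x, Continuous (G · x))
    (ha : ∀ u : ℝ → ℝ, u 0 = a →
      (∀ t ∈ Icc 0 p, HasDerivWithinAt u (G t (u t)) (Icc 0 p) t) → a ≤ u p)
    (hb : ∀ u : ℝ → ℝ, u 0 = b →
      (∀ t ∈ Icc 0 p, HasDerivWithinAt u (G t (u t)) (Icc 0 p) t) → u p ≤ b) :
    ∃ u : ℝ → ℝ, u 0 ∈ Icc a b ∧ u p = u 0 ∧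
      ∀ t ∈ Icc 0 p, HasDerivWithinAt u (G t (u t)) (Icc 0 p) t := by
  have hex : ∀ x : ℝ, ∃ u : ℝ → ℝ, u 0 = x ∧
      ∀ t ∈ Icc 0 p, HasDerivWithinAt u (G t (u t)) (Icc 0 p) t := by
    intro x
    have hPL : IsPicardLindelof G (⟨0, left_mem_Icc.2 hp.le⟩ : Icc 0 p) x
        (L * p.toNNReal) 0 L K :=
      { lipschitzOnWith := fun t _ => (hK t).lipschitzOnWith
        continuousOn := fun x _ => (hc x).continuousOn
        norm_le := fun t _ x _ => hL t x
        mul_max_le := by simp [hp.le] }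
    exact hPL.exists_eq_forall_mem_Icc_hasDerivWithinAt₀
  choose u hu0 hu using hex
  have hcont : Continuous fun x => u x p := by
    refine (LipschitzWith.of_dist_le_mul (K := ⟨Real.exp (K * p), (Real.exp_pos _).le⟩)
      fun x y => ?_).continuous
    have hright : ∀ x, ∀ t ∈ Ico 0 p, HasDerivWithinAt (u x) (G t (u x t)) (Ici t) t :=
      fun x t ht => (hu x t (Ico_subset_Icc_self ht)).mono_of_mem_nhdsWithin
        (Filter.mem_of_superset (Icc_mem_nhdsGE ht.2) (Icc_subset_Icc_left ht.1))
    have h := dist_le_of_trajectories_ODE hK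
      (fun t ht => (hu x t ht).continuousWithinAt) (hright x)
      (fun t ht => (hu y t ht).continuousWithinAt) (hright y) le_rfl p (right_mem_Icc.2 hp.le)
    rw [hu0, hu0, sub_zero, mul_comm] at h
    exact h
  obtain ⟨x, hx, hxp⟩ := intermediate_value_Icc hab (hcont.sub continuous_id).neg.continuousOn
    (show (0 : ℝ) ∈ Icc _ _ from
      ⟨by simpa using ha _ (hu0 a) (hu a), by simpa using hb _ (hu0 b) (hu b)⟩)
  refine ⟨u x, by rwa [hu0], ?_, hu x⟩
  rw [hu0]
  simpa [sub_eq_zero, eq_comm] using hxp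

theorem exists_periodic_solution_of_boundary {F : ℝ → ℝ → ℝ} {u : ℝ → ℝ} {p : ℝ} (hp : 0 < p)
    (hF : ∀ t x, F (t + p) x = F t x) (hup : u p = u 0)
    (hu : ∀ t ∈ Icc 0 p, HasDerivWithinAt u (F t (u t)) (Icc 0 p) t) :
    ∃ v : ℝ → ℝ, v 0 = u 0 ∧ Function.Periodic v p ∧ ∀ t, HasDerivAt v (F t (v t)) t := by
  set v : ℝ → ℝ := fun t => u (toIcoMod hp 0 t) with hv
  have hFz : ∀ (n : ℤ) t x, F (t - n * p) x = F t x := fun n t x =>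
    (show Function.Periodic (fun t => F t x) p from fun t => hF t x).sub_int_mul_eq n
  have hshift : ∀ n : ℤ, ∀ t ∈ Icc (n * p) (n * p + p), v t = u (t - n * p) := by
    intro n t ht
    rcases ht.2.lt_or_eq with h | h
    · have : toIcoMod hp 0 t = t - n * p := by
        rw [toIcoMod_eq_iff hp]
        exact ⟨⟨by linarith [ht.1], by linarith⟩, n, by simp⟩
      simp only [hv, this]
    · have : toIcoMod hp 0 t = 0 := by
        rw [toIcoMod_eq_iff hp]
        exact ⟨⟨le_rfl, by linarith⟩, n + 1, by rw [h]; push_cast [zsmul_eq_mul]; ring⟩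
      simp only [hv, this]
      rw [h, add_sub_cancel_left, hup]
  have hder : ∀ n : ℤ, ∀ t ∈ Icc (n * p) (n * p + p),
      HasDerivWithinAt v (F t (v t)) (Icc (n * p) (n * p + p)) t := by
    intro n t ht
    have h1 := hu (t - n * p) ⟨by linarith [ht.1], by linarith [ht.2]⟩
    rw [hFz, ← hshift n t ht] at h1
    have h2 : HasDerivWithinAt (fun s => u (s - n * p)) (F t (v t)) (Icc (n * p) (n * p + p)) t := by
      have := HasDerivWithinAt.comp (h := fun s => s - n * p) t h1
        ((hasDerivAt_id' t).sub_const (n * p)).hasDerivWithinAt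
        fun s (hs : s ∈ Icc (n * p) (n * p + p)) => ⟨by linarith [hs.1], by linarith [hs.2]⟩
      rwa [mul_one] at this
    exact h2.congr (hshift n) (hshift n t ht)
  refine ⟨v, by simp [hv], fun t => by simp [hv], fun t => ?_⟩
  set n : ℤ := toIcoDiv hp 0 t with hn
  have hmem : t ∈ Ico (n * p) (n * p + p) := by
    have := sub_toIcoDiv_zsmul_mem_Ico hp 0 t
    rw [zsmul_eq_mul, ← hn] at this
    exact ⟨by linarith [this.1], by linarith [this.2]⟩
  have hr := hder n t (Ico_subset_Icc_self hmem)
  rcases hmem.1.lt_or_eq with h | h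
  · exact hr.hasDerivAt (Icc_mem_nhds h hmem.2)
  · have hl := hder (n - 1) t (by push_cast; constructor <;> linarith)
    refine (hl.union hr).hasDerivAt ?_
    rw [show ((n - 1 : ℤ) : ℝ) * p + p = n * p by push_cast; ring,
      Icc_union_Icc_eq_Icc (by push_cast; linarith) (by linarith)]
    exact Icc_mem_nhds (by push_cast; linarith) (by linarith)

theorem exists_time_change {h : ℝ → ℝ} {p : ℝ} (hp : 0 < p) (hc : Continuous h)
    (hpos : ∀ s, 0 < h s) (hper : Function.Periodic h p) :
    ∃ (φ : ℝ → ℝ) (T : ℝ), 0 < T ∧ φ 0 = 0 ∧ (∀ t, HasDerivAt φ (h (φ t)) t) ∧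
      ∀ t, φ (t + T) = φ t + p := by
  have hc' : Continuous fun s => (h s)⁻¹ := hc.inv₀ fun s => (hpos s).ne'
  have hper' : Function.Periodic (fun s => (h s)⁻¹) p := fun s => by simp only [hper s]
  set τ : ℝ → ℝ := fun s => ∫ x in (0 : ℝ)..s, (h x)⁻¹ with hτ
  have hd : ∀ s, HasDerivAt τ (h s)⁻¹ s := fun s => hc'.integral_hasStrictDerivAt 0 s |>.hasDerivAt
  have hmono : StrictMono τ := strictMono_of_hasDerivAt_pos hd fun s => inv_pos.2 (hpos s)
  have hτc : Continuous τ := continuous_iff_continuousAt.2 fun s => (hd s).continuousAt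
  have hint : ∀ a b, IntervalIntegrable (fun s => (h s)⁻¹) MeasureTheory.volume a b :=
    fun a b => hc'.intervalIntegrable a b
  have hT : 0 < τ p := by simpa [hτ] using hmono hp
  have hsurj : Function.Surjective τ := hτc.surjective
    (hper'.tendsto_atTop_intervalIntegral_of_pos hT hp) (hper'.tendsto_atBot_intervalIntegral_of_pos hT hp)
  have hadd : ∀ s, τ (s + p) = τ s + τ p := fun s => by
    have := hper'.intervalIntegral_add_eq_add 0 s hint
    simpa [hτ] using this
  let e := hmono.orderIsoOfSurjective τ hsurj
  have he : ∀ s, e s = τ s := fun s => rfl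
  refine ⟨e.symm, τ p, hT, ?_, fun t => ?_, fun t => ?_⟩
  · rw [OrderIso.symm_apply_eq, he]; simp [hτ]
  · have := HasDerivAt.of_local_left_inverse (f := τ) (g := e.symm) (a := t)
      e.symm.continuous.continuousAt (hd (e.symm t)) (inv_pos.2 (hpos _)).ne'
      (Filter.Eventually.of_forall fun y => e.apply_symm_apply y)
    simpa using this
  · rw [OrderIso.symm_apply_eq, he, hadd, ← he (e.symm t), e.apply_symm_apply]

theorem angular_speed_pos {δ r s c : ℝ} (hδ0 : 0 < δ) (hδ1 : δ < 1) (h : s ^ 2 + c ^ 2 = 1) :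
    0 < c * (δ * s - 2 * r * s ^ 2 + c) +
      s ^ 2 * (1 - (1 + 2 * δ) * r * s + 3 * r ^ 2 * s ^ 2 - r * c) := by
  have key : 12 * (c * (δ * s - 2 * r * s ^ 2 + c) +
      s ^ 2 * (1 - (1 + 2 * δ) * r * s + 3 * r ^ 2 * s ^ 2 - r * c)) =
      3 * (2 * (c - r * s ^ 2) + (δ - r * s) * s) ^ 2 +
      s ^ 2 * ((3 * r * s - (δ + 2)) ^ 2 + 4 * (δ + 2) * (1 - δ)) := by ring
  have hδ : 0 < 4 * (δ + 2) * (1 - δ) := by nlinarith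
  rcases eq_or_ne s 0 with rfl | hs
  · nlinarith
  · have : 0 < s ^ 2 * ((3 * r * s - (δ + 2)) ^ 2 + 4 * (δ + 2) * (1 - δ)) := by positivity
    nlinarith [sq_nonneg (2 * (c - r * s ^ 2) + (δ - r * s) * s)]

theorem outer_ellipse_abs_le {μ x y : ℝ} (hμ0 : 0 < μ) (hμ1 : μ < 1 / 40)
    (h : 0 ≤ 1 + 2 * y - x ^ 2 - μ ^ 2 * (10 * x * y + y ^ 2)) :
    |μ * x| ≤ 2 ∧ -(1 / 2) ≤ y := by
  have hμ2 : μ ^ 2 < 1 / 1600 := by nlinarith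
  have hform : (μ * y + 5 * (μ * x)) ^ 2 + x ^ 2 * (1 - 25 * μ ^ 2) ≤ 1 + 2 * y := by nlinarith
  refine ⟨abs_le_of_sq_le_sq ?_ (by norm_num), ?_⟩
  · have h1 : μ ^ 2 * ((μ * y + 5 * (μ * x)) ^ 2 + x ^ 2 * (1 - 25 * μ ^ 2))
        ≤ μ ^ 2 * (1 + 2 * y) := by gcongr
    have h2 : (μ * x) ^ 2 * (1 - 25 * μ ^ 2) ≤ μ ^ 2 + 1 - 10 * μ * (μ * x) := by
      nlinarith [sq_nonneg (μ ^ 2 * y + 5 * μ * (μ * x) - 1)]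
    have h3 : -(10 * μ * (μ * x)) ≤ 1 / 2 + (μ * x) ^ 2 / 8 := by
      nlinarith [sq_nonneg (20 * μ + (μ * x) / 2)]
    nlinarith [sq_nonneg (μ * x)]
  · nlinarith [sq_nonneg (μ * y + 5 * (μ * x)), sq_nonneg x]

theorem outer_ellipse_bounded {μ : ℝ} (hμ0 : 0 < μ) (hμ1 : μ < 1 / 40) :
    ∃ M : ℝ, 1 ≤ M ∧ ∀ x y : ℝ, 0 ≤ 1 + 2 * y - x ^ 2 - μ ^ 2 * (10 * x * y + y ^ 2) →
      x ^ 2 + (y + x ^ 2) ^ 2 ≤ M ^ 2 := by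
  obtain ⟨A, hA0, hμA⟩ : ∃ A : ℝ, 0 < A ∧ μ * A = 2 := ⟨2 / μ, by positivity, by field_simp⟩
  refine ⟨1 + A + 2 * A ^ 2, by nlinarith, fun x y h => ?_⟩
  obtain ⟨hX, hy⟩ := outer_ellipse_abs_le hμ0 hμ1 h
  have hx : |x| ≤ A := by
    rw [abs_mul, abs_of_pos hμ0, ← hμA] at hX
    exact le_of_mul_le_mul_left hX hμ0
  have hyA : |y| ≤ A ^ 2 := by
    have hA1 : 1 < A := by nlinarith
    refine abs_le.2 ⟨by nlinarith, ?_⟩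
    by_contra! hc
    have h1 : -(1 / 2) ≤ 10 * μ * (μ * x) := by nlinarith [(abs_le.1 hX).1]
    have h2 : μ ^ 2 * A ^ 2 = 4 := by rw [← mul_pow, hμA]; norm_num
    have h3 : 4 * y < μ ^ 2 * y ^ 2 := by
      have : μ ^ 2 * A ^ 2 * y < μ ^ 2 * y * y := by
        have : 0 < y := by nlinarith
        rw [mul_assoc, mul_assoc]
        gcongr
      nlinarith
    nlinarith [sq_nonneg x]
  have hx2 : x ^ 2 ≤ A ^ 2 := sq_le_sq' (abs_le.1 hx).1 (abs_le.1 hx).2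
  have hz : |y + x ^ 2| ≤ 2 * A ^ 2 := by
    rw [abs_le] at hyA ⊢
    constructor <;> nlinarith [sq_nonneg x]
  have hz2 : (y + x ^ 2) ^ 2 ≤ (2 * A ^ 2) ^ 2 := sq_le_sq' (abs_le.1 hz).1 (abs_le.1 hz).2
  have : 0 < A ^ 3 := by positivity
  nlinarith

theorem outer_ellipse_transversal {δ μ x y : ℝ} (hδ0 : 0 < δ) (hμ0 : 0 < μ) (hμ : 40 * μ = 1 - δ)
    (h : 1 + 2 * y - x ^ 2 - μ ^ 2 * (10 * x * y + y ^ 2) = 0) :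
    0 < (-2 * x - 10 * μ ^ 2 * y) * (δ * x + x ^ 2 - y) +
      (2 - 10 * μ ^ 2 * x - 2 * μ ^ 2 * y) * (x * (1 + x + y)) := by
  have hμ1 : μ < 1 / 40 := by linarith
  obtain ⟨hX, hy⟩ := outer_ellipse_abs_le hμ0 hμ1 h.ge
  obtain ⟨hX1, hX2⟩ := abs_le.1 hX
  have key : (-2 * x - 10 * μ ^ 2 * y) * (δ * x + x ^ 2 - y) +
      (2 - 10 * μ ^ 2 * x - 2 * μ ^ 2 * y) * (x * (1 + x + y)) =
      2 * (x ^ 2 * (40 * μ - 5 * μ ^ 2 - 5 * μ * (μ * x)) +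
        μ ^ 2 * (3 * y ^ 2 - (5 * δ + 1) * x * y - y + 10 * μ * (μ * x) * y ^ 2 + μ ^ 2 * y ^ 3)) := by
    obtain rfl : δ = 1 - 40 * μ := by linarith
    linear_combination (2 * x + 2 * μ ^ 2 * y) * h
  rw [key]
  have hx2 := sq_nonneg x
  have hy2 := sq_nonneg y
  have h1 : x ^ 2 * (20 * μ) ≤ x ^ 2 * (40 * μ - 5 * μ ^ 2 - 5 * μ * (μ * x)) := by
    gcongr; nlinarith
  have h2 : -(y ^ 2 / 2) ≤ 10 * μ * (μ * x) * y ^ 2 := by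
    have : -(1 / 2) ≤ 10 * μ * (μ * x) := by nlinarith
    nlinarith
  have h3 : -(y ^ 2 / 10) ≤ μ ^ 2 * y ^ 3 := by
    have : -(1 / 10) ≤ μ ^ 2 * y := by nlinarith
    nlinarith
  have h4 : (5 * δ + 1) * x * y ≤ y ^ 2 / 2 + 18 * x ^ 2 := by
    have : (5 * δ + 1) ^ 2 ≤ 6 ^ 2 := by gcongr; linarith
    nlinarith [sq_nonneg (y - (5 * δ + 1) * x), mul_le_mul_of_nonneg_right this hx2]
  have h5 : μ ^ 2 * (19 / 10 * y ^ 2 - y - 18 * x ^ 2) ≤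
    μ ^ 2 * (3 * y ^ 2 - (5 * δ + 1) * x * y - y + 10 * μ * (μ * x) * y ^ 2 + μ ^ 2 * y ^ 3) := by
    gcongr; linarith
  have h6 : μ ^ 2 * (18 * x ^ 2) ≤ μ * x ^ 2 := by nlinarith [mul_nonneg hμ0.le hx2]
  suffices 0 < 19 * μ * x ^ 2 + μ ^ 2 * (19 / 10 * y ^ 2 - y) by linarith
  suffices 0 < 19 * x ^ 2 + μ * (19 / 10 * y ^ 2 - y) by nlinarith
  rcases lt_trichotomy y 0 with hy0 | rfl | hy0
  · have : 0 < 19 / 10 * y ^ 2 - y := by nlinarith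
    positivity
  · nlinarith
  · rcases le_total y 1 with hy1 | hy1
    · have h7 : 10 * μ * (μ * x) ≤ 1 / 2 := by nlinarith
      have h8 : μ ^ 2 * y ^ 2 ≤ 1 * y := by
        rw [sq y, ← mul_assoc]
        gcongr
        nlinarith
      have h9 : 1 ≤ x ^ 2 := by
        linarith [mul_le_mul_of_nonneg_right h7 hy0.le]
      have h10 : μ * y ≤ 1 := mul_le_one₀ (by linarith) hy0.le hy1
      have : 0 ≤ μ * (19 / 10 * y ^ 2) := by positivity
      linarith
    · have : 0 < 19 / 10 * y ^ 2 - y := by nlinarith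
      positivity

theorem inner_ellipse_sq_add_sq_le {δ x y : ℝ} (hδ0 : 0 < δ) (hδ1 : δ < 1)
    (h : x ^ 2 - δ * x * y + y ^ 2 = (δ / 200) ^ 2) : x ^ 2 + y ^ 2 ≤ 2 * (δ / 200) ^ 2 := by
  nlinarith [sq_nonneg (x - y), sq_nonneg (x + y)]

theorem inner_ellipse_bounded {δ M x y : ℝ} (hδ0 : 0 < δ) (hδ1 : δ < 1) (hM : 1 ≤ M)
    (h : x ^ 2 - δ * x * y + y ^ 2 = (δ / 200) ^ 2) : x ^ 2 + (y + x ^ 2) ^ 2 ≤ M ^ 2 := by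
  have hr := inner_ellipse_sq_add_sq_le hδ0 hδ1 h
  have hx : x ^ 2 ≤ 1 / 10 := by nlinarith [sq_nonneg y]
  have hy : y ^ 2 ≤ 1 / 10 := by nlinarith [sq_nonneg x]
  nlinarith [sq_nonneg (y - x ^ 2), sq_nonneg x]

theorem inner_ellipse_transversal {δ x y : ℝ} (hδ0 : 0 < δ) (hδ1 : δ < 1)
    (h : x ^ 2 - δ * x * y + y ^ 2 = (δ / 200) ^ 2) :
    0 < (2 * x - δ * y) * (δ * x + x ^ 2 - y) + (2 * y - δ * x) * (x * (1 + x + y)) := by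
  have hr := inner_ellipse_sq_add_sq_le hδ0 hδ1 h
  have hx : |x| ≤ δ / 100 := abs_le_of_sq_le_sq (by nlinarith [sq_nonneg y]) (by positivity)
  have hy : |y| ≤ δ / 100 := abs_le_of_sq_le_sq (by nlinarith [sq_nonneg x]) (by positivity)
  have key : (2 * x - δ * y) * (δ * x + x ^ 2 - y) + (2 * y - δ * x) * (x * (1 + x + y)) =
      δ * (δ / 200) ^ 2 + x * ((2 - δ) * x ^ 2 + (2 - 2 * δ) * (x * y) + 2 * y ^ 2) := by
    linear_combination δ * h
  rw [key]
  have hq : |(2 - δ) * x ^ 2 + (2 - 2 * δ) * (x * y) + 2 * y ^ 2| ≤ 3 * (x ^ 2 + y ^ 2) := by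
    rw [abs_le]
    constructor <;> nlinarith [sq_nonneg (x - y), sq_nonneg (x + y), sq_nonneg x, sq_nonneg y]
  have := mul_le_mul hx (hq.trans (by linarith : _ ≤ 6 * (δ / 200) ^ 2)) (abs_nonneg _) (by positivity)
  rw [← abs_mul] at this
  have h3 := (abs_le.1 this).1
  have : 0 < δ ^ 3 := by positivity
  nlinarith

noncomputable section

/-- Angular speed of the system in the coordinates `(x, y + x²) = (-r sin θ, r cos θ)`. -/
def angularSpeed (δ θ r : ℝ) : ℝ :=
  Real.cos θ * (δ * Real.sin θ - 2 * r * Real.sin θ ^ 2 + Real.cos θ) +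
    Real.sin θ ^ 2 * (1 - (1 + 2 * δ) * r * Real.sin θ + 3 * r ^ 2 * Real.sin θ ^ 2
      - r * Real.cos θ)

/-- Radial speed of the system in the coordinates `(x, y + x²) = (-r sin θ, r cos θ)`. -/
def radialSpeed (δ θ r : ℝ) : ℝ :=
  r * (Real.sin θ * (δ * Real.sin θ - 2 * r * Real.sin θ ^ 2 + Real.cos θ) -
    Real.cos θ * Real.sin θ * (1 - (1 + 2 * δ) * r * Real.sin θ + 3 * r ^ 2 * Real.sin θ ^ 2
      - r * Real.cos θ))

/-- Slope `dr/dθ` of the orbits in polar coordinates. -/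
def polarSlope (δ θ r : ℝ) : ℝ := radialSpeed δ θ r / angularSpeed δ θ r

/-- Abscissa of the point with polar coordinates `(r, θ)`. -/
def polarX (θ r : ℝ) : ℝ := -(r * Real.sin θ)

/-- Ordinate of the point with polar coordinates `(r, θ)`. -/
def polarY (θ r : ℝ) : ℝ := r * Real.cos θ - (r * Real.sin θ) ^ 2

/-- The polar slope with both arguments clamped to a compact box. -/
def clampedSlope (δ M θ r : ℝ) : ℝ :=
  polarSlope δ (max 0 (min (2 * Real.pi) θ)) (max (-M) (min M r))

end

theorem angularSpeed_pos {δ : ℝ} (hδ0 : 0 < δ) (hδ1 : δ < 1) (θ r : ℝ) :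
    0 < angularSpeed δ θ r :=
  angular_speed_pos hδ0 hδ1 (Real.sin_sq_add_cos_sq θ)

theorem polarX_sq_add (θ r : ℝ) : polarX θ r ^ 2 + (polarY θ r + polarX θ r ^ 2) ^ 2 = r ^ 2 := by
  unfold polarX polarY
  linear_combination r ^ 2 * Real.sin_sq_add_cos_sq θ

theorem contDiff_polarSlope {δ : ℝ} (hδ0 : 0 < δ) (hδ1 : δ < 1) :
    ContDiff ℝ 1 fun q : ℝ × ℝ => polarSlope δ q.1 q.2 := by
  refine ContDiff.div ?_ ?_ fun q => (angularSpeed_pos hδ0 hδ1 q.1 q.2).ne'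
  · unfold radialSpeed; fun_prop
  · unfold angularSpeed; fun_prop

theorem clampedSlope_eq {δ M θ r : ℝ} (hθ : θ ∈ Icc 0 (2 * Real.pi)) (hr : |r| ≤ M) :
    clampedSlope δ M θ r = polarSlope δ θ r := by
  rw [abs_le] at hr
  simp [clampedSlope, hθ.1, hθ.2, hr.1, hr.2]

theorem exists_clampedSlope_bounds {δ : ℝ} (hδ0 : 0 < δ) (hδ1 : δ < 1) {M : ℝ} (hM : 0 ≤ M) :
    ∃ K L : NNReal, (∀ θ, LipschitzWith K (clampedSlope δ M θ)) ∧
      ∀ θ r, ‖clampedSlope δ M θ r‖ ≤ L := by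
  have hF := contDiff_polarSlope hδ0 hδ1
  have hbox : IsCompact (Icc 0 (2 * Real.pi) ×ˢ Icc (-M) M) := isCompact_Icc.prod isCompact_Icc
  have hmem : ∀ θ r : ℝ, (max 0 (min (2 * Real.pi) θ), max (-M) (min M r)) ∈
      Icc 0 (2 * Real.pi) ×ˢ Icc (-M) M := fun θ r =>
    ⟨⟨le_max_left _ _, max_le (by positivity) (min_le_left _ _)⟩,
      ⟨le_max_left _ _, max_le (by linarith) (min_le_left _ _)⟩⟩
  obtain ⟨K, hK⟩ := (hF.locallyLipschitz.locallyLipschitzOn).exists_lipschitzOnWith_of_compact hbox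
  obtain ⟨L, hL⟩ := hbox.exists_bound_of_continuousOn hF.continuous.continuousOn
  refine ⟨K, L.toNNReal, fun θ => LipschitzWith.of_dist_le_mul fun r r' => ?_, fun θ r => ?_⟩
  · refine (hK.dist_le_mul _ (hmem θ r) _ (hmem θ r')).trans ?_
    gcongr
    have h : LipschitzWith 1 fun r : ℝ => max (-M) (min M r) :=
      (LipschitzWith.id.const_min M).const_max (-M)
    simpa [Prod.dist_eq] using h.dist_le_mul r r'
  · exact (hL _ (hmem θ r)).trans (Real.le_coe_toNNReal L)

theorem continuous_clampedSlope {δ : ℝ} (hδ0 : 0 < δ) (hδ1 : δ < 1) (M r : ℝ) :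
    Continuous fun θ => clampedSlope δ M θ r :=
  (contDiff_polarSlope hδ0 hδ1).continuous.comp (by fun_prop : Continuous fun θ : ℝ =>
    (max 0 (min (2 * Real.pi) θ), max (-M) (min M r)))

theorem hasDerivWithinAt_polarX {u : ℝ → ℝ} {u' θ : ℝ} {s : Set ℝ}
    (hu : HasDerivWithinAt u u' s θ) :
    HasDerivWithinAt (fun t => polarX t (u t)) (-(u' * Real.sin θ + u θ * Real.cos θ)) s θ :=
  (hu.mul (Real.hasDerivAt_sin θ).hasDerivWithinAt).neg

theorem hasDerivWithinAt_polarY {u : ℝ → ℝ} {u' θ : ℝ} {s : Set ℝ}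
    (hu : HasDerivWithinAt u u' s θ) :
    HasDerivWithinAt (fun t => polarY t (u t))
      (u' * Real.cos θ - u θ * Real.sin θ -
        2 * (u θ * Real.sin θ) * (u' * Real.sin θ + u θ * Real.cos θ)) s θ := by
  have := (hu.mul (Real.hasDerivAt_cos θ).hasDerivWithinAt).sub
    ((hu.mul (Real.hasDerivAt_sin θ).hasDerivWithinAt).pow 2)
  refine this.congr_deriv ?_
  simp only [Pi.mul_apply]
  ring

theorem polarX_deriv_mul_angularSpeed {δ : ℝ} (hδ0 : 0 < δ) (hδ1 : δ < 1) (θ r : ℝ) :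
    -(polarSlope δ θ r * Real.sin θ + r * Real.cos θ) * angularSpeed δ θ r =
      δ * polarX θ r + polarX θ r ^ 2 - polarY θ r := by
  have h : polarSlope δ θ r * angularSpeed δ θ r = radialSpeed δ θ r :=
    div_mul_cancel₀ _ (angularSpeed_pos hδ0 hδ1 θ r).ne'
  have hsc := Real.sin_sq_add_cos_sq θ
  calc _ = -(radialSpeed δ θ r * Real.sin θ + r * Real.cos θ * angularSpeed δ θ r) := by
        rw [← h]; ring
    _ = _ := by
        unfold radialSpeed angularSpeed polarX polarY
        linear_combination r * (-δ * Real.sin θ + 2 * r * Real.sin θ ^ 2 - Real.cos θ) * hsc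

theorem polarY_deriv_mul_angularSpeed {δ : ℝ} (hδ0 : 0 < δ) (hδ1 : δ < 1) (θ r : ℝ) :
    (polarSlope δ θ r * Real.cos θ - r * Real.sin θ -
        2 * (r * Real.sin θ) * (polarSlope δ θ r * Real.sin θ + r * Real.cos θ)) *
        angularSpeed δ θ r =
      polarX θ r * (1 + polarX θ r + polarY θ r) := by
  have h : polarSlope δ θ r * angularSpeed δ θ r = radialSpeed δ θ r :=
    div_mul_cancel₀ _ (angularSpeed_pos hδ0 hδ1 θ r).ne'
  have hsc := Real.sin_sq_add_cos_sq θ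
  have h1 := polarX_deriv_mul_angularSpeed hδ0 hδ1 θ r
  have h2 : polarSlope δ θ r * Real.cos θ * angularSpeed δ θ r
      - r * Real.sin θ * angularSpeed δ θ r =
      -(r * Real.sin θ * (1 - (1 + 2 * δ) * r * Real.sin θ + 3 * r ^ 2 * Real.sin θ ^ 2
      - r * Real.cos θ)) := by
    calc _ = radialSpeed δ θ r * Real.cos θ - r * Real.sin θ * angularSpeed δ θ r := by
          rw [← h]; ring
      _ = _ := by
          unfold radialSpeed angularSpeed
          linear_combination -(r * Real.sin θ * (1 - (1 + 2 * δ) * r * Real.sin θ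
            + 3 * r ^ 2 * Real.sin θ ^ 2 - r * Real.cos θ)) * hsc
  calc _ = (polarSlope δ θ r * Real.cos θ * angularSpeed δ θ r
      - r * Real.sin θ * angularSpeed δ θ r) + 2 * (r * Real.sin θ) *
        (-(polarSlope δ θ r * Real.sin θ + r * Real.cos θ) * angularSpeed δ θ r) := by ring
    _ = _ := by
        rw [h1, h2]
        unfold polarX polarY
        ring

theorem nonneg_of_transversal {δ M : ℝ} (hδ0 : 0 < δ) (hδ1 : δ < 1) (hM : 0 ≤ M)
    {B Bx By : ℝ → ℝ → ℝ}
    (hB : ∀ {X Y : ℝ → ℝ} {X' Y' t : ℝ} {s : Set ℝ}, HasDerivWithinAt X X' s t →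
      HasDerivWithinAt Y Y' s t →
      HasDerivWithinAt (fun t => B (X t) (Y t)) (Bx (X t) (Y t) * X' + By (X t) (Y t) * Y') s t)
    (hBM : ∀ x y, B x y = 0 → x ^ 2 + (y + x ^ 2) ^ 2 ≤ M ^ 2)
    (hBpos : ∀ x y, B x y = 0 →
      0 < Bx x y * (δ * x + x ^ 2 - y) + By x y * (x * (1 + x + y)))
    {u : ℝ → ℝ}
    (hu : ∀ θ ∈ Icc 0 (2 * Real.pi),
      HasDerivWithinAt u (clampedSlope δ M θ (u θ)) (Icc 0 (2 * Real.pi)) θ)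
    (h0 : 0 ≤ B (polarX 0 (u 0)) (polarY 0 (u 0))) :
    ∀ θ ∈ Icc 0 (2 * Real.pi), 0 ≤ B (polarX θ (u θ)) (polarY θ (u θ)) := by
  have hd := fun θ hθ => hB (hasDerivWithinAt_polarX (hu θ hθ)) (hasDerivWithinAt_polarY (hu θ hθ))
  refine image_le_of_deriv_right_lt_deriv_boundary' continuousOn_const
    (fun θ _ => hasDerivWithinAt_const θ _ 0) h0 (fun θ hθ => (hd θ hθ).continuousWithinAt)
    (fun θ hθ => (hd θ (Ico_subset_Icc_self hθ)).mono_of_mem_nhdsWithin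
      (Filter.mem_of_superset (Icc_mem_nhdsGE hθ.2) (Icc_subset_Icc_left hθ.1))) ?_
  intro θ hθ hz
  have hr : |u θ| ≤ M := by
    have := hBM _ _ hz.symm
    rw [polarX_sq_add] at this
    exact abs_le_of_sq_le_sq this hM
  rw [clampedSlope_eq (Ico_subset_Icc_self hθ) hr]
  have hp := hBpos _ _ hz.symm
  rw [← polarX_deriv_mul_angularSpeed hδ0 hδ1, ← polarY_deriv_mul_angularSpeed hδ0 hδ1,
    ← mul_assoc, ← mul_assoc, ← add_mul] at hp
  exact pos_of_mul_pos_left hp (angularSpeed_pos hδ0 hδ1 _ _).le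

theorem exists_periodic_polar_solution {δ : ℝ} (hδ0 : 0 < δ) (hδ1 : δ < 1) :
    ∃ v : ℝ → ℝ, 0 < v 0 ∧ Function.Periodic v (2 * Real.pi) ∧
      ∀ θ, HasDerivAt v (polarSlope δ θ (v θ)) θ := by
  have hp : 0 < 2 * Real.pi := Real.two_pi_pos
  obtain ⟨μ, hμ⟩ : ∃ μ : ℝ, 40 * μ = 1 - δ := ⟨(1 - δ) / 40, by ring⟩
  have hμ0 : 0 < μ := by linarith
  have hμ1 : μ < 1 / 40 := by linarith
  obtain ⟨M, hM1, hM⟩ := outer_ellipse_bounded hμ0 hμ1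
  have hM0 : 0 ≤ M := by linarith
  obtain ⟨K, L, hK, hL⟩ := exists_clampedSlope_bounds hδ0 hδ1 hM0
  have houter := fun u => nonneg_of_transversal hδ0 hδ1 hM0 (u := u)
    (B := fun x y => 1 + 2 * y - x ^ 2 - μ ^ 2 * (10 * x * y + y ^ 2))
    (Bx := fun x y => -2 * x - 10 * μ ^ 2 * y) (By := fun x y => 2 - 10 * μ ^ 2 * x - 2 * μ ^ 2 * y)
    (fun hX hY => by
      refine ((((hY.const_mul 2).const_add 1).sub (hX.pow 2)).sub
        ((((hX.const_mul 10).mul hY).add (hY.pow 2)).const_mul (μ ^ 2))).congr_deriv ?_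
      push_cast
      ring)
    (fun x y h => hM x y h.ge) (fun x y h => outer_ellipse_transversal hδ0 hμ0 hμ h)
  have hinner := fun u => nonneg_of_transversal hδ0 hδ1 hM0 (u := u)
    (B := fun x y => x ^ 2 - δ * x * y + y ^ 2 - (δ / 200) ^ 2)
    (Bx := fun x y => 2 * x - δ * y) (By := fun x y => 2 * y - δ * x)
    (fun hX hY => by
      refine ((((hX.pow 2).sub ((hX.const_mul δ).mul hY)).add (hY.pow 2)).sub_const
        ((δ / 200) ^ 2)).congr_deriv ?_
      push_cast
      ring)
    (fun x y h => inner_ellipse_bounded hδ0 hδ1 hM1 (sub_eq_zero.1 h))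
    (fun x y h => inner_ellipse_transversal hδ0 hδ1 (sub_eq_zero.1 h))
  set S := √(1 + μ ^ 2) with hS
  have hS2 : S ^ 2 = 1 + μ ^ 2 := Real.sq_sqrt (by positivity)
  have hS1 : 1 ≤ S := Real.one_le_sqrt.2 (by nlinarith)
  have hμsq : 0 < μ ^ 2 := by positivity
  obtain ⟨b, hb⟩ : ∃ b, μ ^ 2 * b = 1 + S := ⟨(1 + S) / μ ^ 2, by field_simp⟩
  have hb1 : 1 ≤ b := by nlinarith
  have hray : ∀ y, 0 < y → y ≤ b → 0 ≤ 1 + 2 * y - μ ^ 2 * y ^ 2 := fun y hy0 hyb => by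
    have h1 : μ ^ 2 * y ≤ 1 + S := hb ▸ by gcongr
    have h2 : 0 < μ ^ 2 * y := by positivity
    refine nonneg_of_mul_nonneg_right (a := μ ^ 2) ?_ hμsq
    nlinarith
  obtain ⟨u, hu0, hup, hu⟩ := exists_periodic_boundary_solution (a := δ / 200) (b := b) hp
    (by linarith) hK hL (continuous_clampedSlope hδ0 hδ1 M)
    (fun u hu0 hu => by
      have h := hinner u hu (by simp [polarX, polarY, hu0])
      have hne : ∀ θ ∈ Icc 0 (2 * Real.pi), u θ ≠ 0 := fun θ hθ h0 => by
        have := h θ hθ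
        simp [polarX, polarY, h0] at this
        nlinarith
      have hpos : 0 < u (2 * Real.pi) := by
        by_contra! hneg
        obtain ⟨θ, hθ, hz⟩ := intermediate_value_Icc' hp.le
          (fun θ hθ => (hu θ hθ).continuousWithinAt) (show (0 : ℝ) ∈ Icc _ _ from
            ⟨hneg, by rw [hu0]; positivity⟩)
        exact hne θ hθ hz
      have := h _ (right_mem_Icc.2 hp.le)
      simp [polarX, polarY] at this
      exact abs_le_of_sq_le_sq' this hpos.le |>.2)
    (fun u hu0 hu => by
      have := houter u hu (by
        simpa [polarX, polarY, hu0] using hray b (by linarith) le_rfl) _ (right_mem_Icc.2 hp.le)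
      simp [polarX, polarY] at this
      by_contra! hc
      have h1 : 1 + S < μ ^ 2 * u (2 * Real.pi) := hb ▸ by gcongr
      nlinarith)
  have hu0' : 0 < u 0 := lt_of_lt_of_le (by positivity) hu0.1
  have hC := houter u hu (by simpa [polarX, polarY] using hray _ hu0' hu0.2)
  have hsol : ∀ θ ∈ Icc 0 (2 * Real.pi),
      HasDerivWithinAt u (polarSlope δ θ (u θ)) (Icc 0 (2 * Real.pi)) θ := fun θ hθ => by
    have h := hM _ _ (hC θ hθ)
    rw [polarX_sq_add] at h
    rw [← clampedSlope_eq hθ (abs_le_of_sq_le_sq h hM0)]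
    exact hu θ hθ
  obtain ⟨v, hv0, hvp, hv⟩ := exists_periodic_solution_of_boundary hp
    (fun θ r => by simp [polarSlope, radialSpeed, angularSpeed]) hup hsol
  exact ⟨v, hv0 ▸ hu0', hvp, hv⟩


/-- For each `δ ∈ (0,1)`, the quadratic system `ẋ = δx + x² - y, ẏ = x(1 + x + y)`
has at least one nonconstant periodic solution. -/
theorem exists_periodic_orbit_quadratic
    (δ : ℝ) (hδ0 : 0 < δ) (hδ1 : δ < 1) :
    ∃ (γ : ℝ → ℝ × ℝ) (T : ℝ), 0 < T ∧
      (∀ t : ℝ, HasDerivAt γ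
        (δ * (γ t).1 + (γ t).1 ^ 2 - (γ t).2,
         (γ t).1 * (1 + (γ t).1 + (γ t).2)) t) ∧
      (∀ t : ℝ, γ (t + T) = γ t) ∧
      (∃ t₁ t₂ : ℝ, γ t₁ ≠ γ t₂) := by
  obtain ⟨v, hv0, hvp, hv⟩ := exists_periodic_polar_solution hδ0 hδ1
  have hvc : Continuous v := continuous_iff_continuousAt.2 fun θ => (hv θ).continuousAt
  obtain ⟨φ, T, hT, hφ0, hφ, hφT⟩ := exists_time_change (h := fun θ => angularSpeed δ θ (v θ))
    Real.two_pi_pos (by unfold angularSpeed; fun_prop)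
    (fun θ => angularSpeed_pos hδ0 hδ1 θ (v θ)) (fun θ => by simp [angularSpeed, hvp θ])
  have hγ : ∀ t, HasDerivAt (fun t => (polarX (φ t) (v (φ t)), polarY (φ t) (v (φ t))))
      (δ * polarX (φ t) (v (φ t)) + polarX (φ t) (v (φ t)) ^ 2 - polarY (φ t) (v (φ t)),
        polarX (φ t) (v (φ t)) * (1 + polarX (φ t) (v (φ t)) + polarY (φ t) (v (φ t)))) t := by
    intro t
    have hX := (hasDerivWithinAt_polarX (hv (φ t)).hasDerivWithinAt).hasDerivAt Filter.univ_mem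
    have hY := (hasDerivWithinAt_polarY (hv (φ t)).hasDerivWithinAt).hasDerivAt Filter.univ_mem
    rw [← polarX_deriv_mul_angularSpeed hδ0 hδ1, ← polarY_deriv_mul_angularSpeed hδ0 hδ1]
    exact (hX.comp t (hφ t)).prodMk (hY.comp t (hφ t))
  refine ⟨_, T, hT, hγ, fun t => ?_, ?_⟩
  · simp [hφT, hvp (φ t), polarX, polarY]
  · by_contra! hconst
    have h0 := (hγ 0).unique ((hasDerivAt_const 0 _).congr_of_eventuallyEq
      (Filter.Eventually.of_forall fun t => hconst t 0))
    simp [hφ0, polarX, polarY, hv0.ne'] at h0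
end

section
/- Let δ ∈ (0, 647/1000], set b₀ = −(43δ + 57)/200, D = b₀²(2b₀²δ² − 14b₀²δ − 25b₀² + 4b₀δ² − 14b₀δ − 18b₀ + 2δ² − 9), and define the polynomial N(x,y) = D + 9(b₀+1)⁴x² − 12(b₀+1)²(b₀δ+b₀+δ)xy + (18b₀³ + 2b₀²δ² − 14b₀²δ + 29b₀² + 4b₀δ² − 14b₀δ + 36b₀ + 2δ² + 9)y² + 12b₀(b₀+1)²(b₀δ+b₀+δ)x − 2b₀(9b₀³ + 2b₀²δ² − 14b₀²δ + 2b₀² + 4b₀δ² − 14b₀δ + 9b₀ + 2δ²)y. Let P(x,y) = δx + x² − y, Q(x,y) = x(1+x+y), and Ṅ = P·∂N/∂x + Q·∂N/∂y. Then the set C = {(x,y) ∈ ℝ² : N(x,y) = 0} is nonempty and bounded (an ellipse), Ṅ does not take both strictly positive and strictly negative values on C, and the set {p ∈ C : Ṅ(p) = 0} is finite. -/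
/-- The directional derivative of a general quadratic function on the plane. -/
lemma fderiv_quadratic_apply (k a e c f g : ℝ) (p v : ℝ × ℝ) :
    fderiv ℝ (fun q : ℝ × ℝ ↦
      k + a * q.1 ^ 2 + e * (q.1 * q.2) + c * q.2 ^ 2 + f * q.1 + g * q.2) p v =
      (2 * a * p.1 + e * p.2 + f) * v.1 + (e * p.1 + 2 * c * p.2 + g) * v.2 := by
  have h₁ : HasFDerivAt (fun q : ℝ × ℝ ↦ q.1) (ContinuousLinearMap.fst ℝ ℝ ℝ) p := hasFDerivAt_fst
  have h₂ : HasFDerivAt (fun q : ℝ × ℝ ↦ q.2) (ContinuousLinearMap.snd ℝ ℝ ℝ) p := hasFDerivAt_snd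
  have h := ((((((h₁.pow 2).const_mul a).const_add k).add ((h₁.mul h₂).const_mul e)).add
    ((h₂.pow 2).const_mul c)).add (h₁.const_mul f)).add (h₂.const_mul g)
  refine (congrArg (· v) h.fderiv).trans ?_
  simp
  ring

/-- A binary quadratic form with positive leading coefficient and negative discriminant is
positive at every point with nonzero second coordinate. -/
lemma quadratic_form_pos {a e c : ℝ} (ha : 0 < a) (hdisc : e ^ 2 < 4 * a * c) (x : ℝ) {y : ℝ}
    (hy : y ≠ 0) : 0 < a * x ^ 2 + e * x * y + c * y ^ 2 := by
  have hy2 : 0 < y ^ 2 := by positivity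
  have h : 0 < 4 * a * (a * x ^ 2 + e * x * y + c * y ^ 2) := by
    nlinarith [sq_nonneg (2 * a * x + e * y), mul_pos (sub_pos.2 hdisc) hy2]
  exact pos_of_mul_pos_right h (by positivity)

/-- The zero set of `(αx - βy)² + my² - Ky`, with `α ≠ 0` and `m > 0`, is bounded. -/
lemma isBounded_setOf_sq_add_eq {α m : ℝ} (β K y₀ : ℝ) (hα : α ≠ 0) (hm : 0 < m) :
    Bornology.IsBounded {p : ℝ × ℝ |
      (α * p.1 - β * (p.2 - y₀)) ^ 2 + m * (p.2 - y₀) ^ 2 = K * (p.2 - y₀)} := by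
  let φ : ℝ × ℝ → ℝ × ℝ := fun q ↦ ((q.1 + β * q.2) / α, q.2 + y₀)
  have hφ : Continuous φ := by fun_prop
  have hc : IsCompact (φ '' (Set.Icc (-(K ^ 2 / m + 1)) (K ^ 2 / m + 1) ×ˢ
      Set.Icc (-(|K| / m)) (|K| / m))) := (isCompact_Icc.prod isCompact_Icc).image hφ
  refine hc.isBounded.subset ?_
  rintro ⟨x, y⟩ h
  simp only [Set.mem_ofPred_eq] at h
  set z := y - y₀ with hz
  set w := α * x - β * z with hw
  have hzK : |z| ≤ |K| / m := by
    rcases eq_or_ne z 0 with h0 | h0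
    · rw [h0, abs_zero]; positivity
    · have h1 : m * |z| * |z| ≤ |K| * |z| := by
        rw [← abs_mul, mul_assoc, abs_mul_abs_self]
        nlinarith [le_abs_self (K * z), sq_nonneg w]
      rw [le_div_iff₀ hm]
      linarith [le_of_mul_le_mul_right h1 (abs_pos.2 h0)]
  have hwK : |w| ≤ K ^ 2 / m + 1 := by
    have h1 : w ^ 2 ≤ K ^ 2 / m := calc
      w ^ 2 ≤ K * z := by nlinarith [mul_nonneg hm.le (sq_nonneg z)]
      _ ≤ |K| * |z| := by rw [← abs_mul]; exact le_abs_self _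
      _ ≤ |K| * (|K| / m) := by gcongr
      _ = K ^ 2 / m := by rw [← mul_div_assoc, abs_mul_abs_self, sq]
    nlinarith [sq_nonneg (|w| - 1), sq_abs w]
  refine ⟨(w, z), ⟨abs_le.1 hwK, abs_le.1 hzK⟩, ?_⟩
  simp only [φ, Prod.mk.injEq]
  constructor
  · field_simp
    rw [hw]; ring
  · rw [hz]; ring

namespace ExteriorEllipse

noncomputable section

/-- The factor shared by the `x y` and `x` coefficients of the conic. -/
def mixed (b δ : ℝ) : ℝ := b * δ + b + δ

/-- The coefficient of `y²` in the conic. -/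
def ySq (b δ : ℝ) : ℝ :=
  18 * b ^ 3 + 2 * b ^ 2 * δ ^ 2 - 14 * b ^ 2 * δ + 29 * b ^ 2
    + 4 * b * δ ^ 2 - 14 * b * δ + 36 * b + 2 * δ ^ 2 + 9

/-- Up to a positive factor, the `x²` coefficient of the quadratic form governing the flow
derivative on the conic. -/
def derivXSq (b δ : ℝ) : ℝ :=
  480 - (1440 + 630 * δ) * (b + 1) + (1629 + 1260 * δ + 144 * δ ^ 2) * (b + 1) ^ 2
    - (993 + 657 * δ + 144 * δ ^ 2 - 6 * δ ^ 3) * (b + 1) ^ 3 + 324 * (b + 1) ^ 4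

/-- A factor of the `x y` coefficient of the quadratic form governing the flow derivative on the
conic. -/
def derivXY (b δ : ℝ) : ℝ :=
  32 - (96 + 12 * δ) * (b + 1) + (114 + 24 * δ - 18 * δ ^ 2) * (b + 1) ^ 2
    - (104 + 3 * δ - 18 * δ ^ 2 + 2 * δ ^ 3) * (b + 1) ^ 3 + 54 * (b + 1) ^ 4

/-- The conic in the coordinate `z = y - b` centred at its contact point `(0, b)`. -/
def conic (b δ x z : ℝ) : ℝ :=
  9 * (b + 1) ^ 4 * x ^ 2 - 12 * (b + 1) ^ 2 * mixed b δ * x * z + ySq b δ * z ^ 2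
    + 18 * b * (b + 1) ^ 3 * z

/-- The derivative of `conic` along the flow. -/
def flowDeriv (b δ x z : ℝ) : ℝ :=
  (δ * x + x ^ 2 - (z + b)) * (18 * (b + 1) ^ 4 * x - 12 * (b + 1) ^ 2 * mixed b δ * z)
    + x * (1 + x + (z + b))
      * (-12 * (b + 1) ^ 2 * mixed b δ * x + 2 * ySq b δ * z + 18 * b * (b + 1) ^ 3)

/-- On the conic, the cubic `flowDeriv` is, up to a factor, `z` times a binary quadratic form. -/
lemma flowDeriv_eq_of_conic_eq_zero {b δ x z : ℝ} (hz : z ≠ 0) (h : conic b δ x z = 0) :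
    (18 * b * (b + 1) ^ 3) ^ 2 * flowDeriv b δ x z = 12 * b * (b + 1) ^ 2 * z *
      (3 * derivXSq b δ * ((b + 1) ^ 2 * x) ^ 2
        + 12 * mixed b δ * derivXY b δ * ((b + 1) ^ 2 * x) * z
        + mixed b δ * ySq b δ * (ySq b δ - 18 * (b + 1) ^ 3) * z ^ 2) := by
  obtain ⟨s, rfl⟩ : ∃ s, b = s - 1 := ⟨b + 1, by ring⟩
  apply mul_left_cancel₀ hz
  simp only [conic, flowDeriv, derivXSq, derivXY, mixed, ySq, sub_add_cancel] at h ⊢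
  set c := (s - 1) * δ + (s - 1) + δ with hc
  set C := 18 * (s - 1) ^ 3 + 2 * (s - 1) ^ 2 * δ ^ 2 - 14 * (s - 1) ^ 2 * δ + 29 * (s - 1) ^ 2
    + 4 * (s - 1) * δ ^ 2 - 14 * (s - 1) * δ + 36 * (s - 1) + 2 * δ ^ 2 + 9 with hC
  have hA : 9 * s ^ 4 * x ^ 2 - 12 * s ^ 2 * c * x * z + C * z ^ 2
      = -18 * (s - 1) * s ^ 3 * z := by linear_combination h
  set A := 9 * s ^ 4 * x ^ 2 - 12 * s ^ 2 * c * x * z + C * z ^ 2 with hA'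
  set q := (δ * x - z) * (18 * s ^ 4 * x - 12 * s ^ 2 * c * z) + 18 * (s - 1) * s ^ 3 * x ^ 2
    + s * x * (-12 * s ^ 2 * c * x + 2 * C * z) + 18 * (s - 1) * s ^ 3 * x * z with hq
  set r := x ^ 2 * (18 * s ^ 4 * x - 12 * s ^ 2 * c * z)
    + x * (x + z) * (-12 * s ^ 2 * c * x + 2 * C * z) with hr
  trans 12 * (s - 1) * s ^ 2 * c * A ^ 2 - 18 * (s - 1) * s ^ 3 * A * q
    + (18 * (s - 1) * s ^ 3) ^ 2 * z * r
  · rw [hA]; simp only [hq, hr]; ring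
  · simp only [hA', hq, hr, hC, hc]; ring

section Signs

variable {b δ : ℝ}

lemma mixed_neg (h₀ : 0 < δ) (h₁ : δ ≤ 647 / 1000) (hb : b = -(43 * δ + 57) / 200) :
    mixed b δ < 0 := by
  subst hb
  unfold mixed
  nlinarith

lemma ySq_sub_pos (h₀ : 0 < δ) (h₁ : δ ≤ 647 / 1000) (hb : b = -(43 * δ + 57) / 200) :
    0 < ySq b δ - 4 * mixed b δ ^ 2 := by
  obtain ⟨t, rfl⟩ : ∃ t, δ = 647 / 1000 - t := ⟨647 / 1000 - δ, by ring⟩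
  have ht : 0 ≤ t := by linarith
  subst hb
  unfold ySq mixed
  linarith [pow_nonneg ht 2, pow_nonneg ht 3, mul_nonneg (pow_nonneg ht 3) h₀.le]

lemma derivXSq_pos (h₀ : 0 < δ) (h₁ : δ ≤ 647 / 1000) (hb : b = -(43 * δ + 57) / 200) :
    0 < derivXSq b δ := by
  obtain ⟨t, rfl⟩ : ∃ t, δ = 647 / 1000 - t := ⟨647 / 1000 - δ, by ring⟩
  have ht : 0 ≤ t := by linarith
  subst hb
  unfold derivXSq
  linarith [pow_nonneg ht 2, mul_nonneg (pow_nonneg ht 2) h₀.le,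
    pow_nonneg ht 4, mul_nonneg (pow_nonneg ht 4) h₀.le, mul_nonneg (pow_nonneg ht 5) h₀.le]

lemma derivForm_discrim_pos (h₀ : 0 < δ) (h₁ : δ ≤ 647 / 1000)
    (hb : b = -(43 * δ + 57) / 200) :
    0 < 12 * mixed b δ * derivXY b δ ^ 2
      - ySq b δ * (ySq b δ - 18 * (b + 1) ^ 3) * derivXSq b δ := by
  obtain ⟨t, rfl⟩ : ∃ t, δ = 647 / 1000 - t := ⟨647 / 1000 - δ, by ring⟩
  have ht : 0 ≤ t := by linarith
  subst hb
  unfold mixed derivXY ySq derivXSq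
  linarith [pow_nonneg ht 2, pow_nonneg ht 3, pow_nonneg ht 4, pow_nonneg ht 5,
    mul_nonneg (pow_nonneg ht 5) h₀.le, mul_nonneg (pow_nonneg ht 6) h₀.le,
    pow_nonneg ht 8, pow_nonneg ht 9, mul_nonneg (pow_nonneg ht 9) h₀.le,
    pow_nonneg ht 11, pow_nonneg ht 12, mul_nonneg (pow_nonneg ht 12) h₀.le,
    mul_nonneg (pow_nonneg ht 13) h₀.le]

end Signs

/-- Away from the contact point, the flow crosses the conic strictly in one direction. -/
lemma flowDeriv_neg {b δ x z : ℝ} (h₀ : 0 < δ) (h₁ : δ ≤ 647 / 1000)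
    (hb : b = -(43 * δ + 57) / 200) (h : conic b δ x z = 0) (hz : z ≠ 0) :
    flowDeriv b δ x z < 0 := by
  have hb0 : b < 0 := by linarith
  have hs : 0 < b + 1 := by linarith
  have hz0 : 0 < z := by
    have hm := mul_pos (ySq_sub_pos h₀ h₁ hb) (sq_pos_of_ne_zero hz)
    have hK : 0 < -(18 * b * (b + 1) ^ 3) := by
      have := mul_pos (neg_pos.2 hb0) (pow_pos hs 3)
      linarith
    refine pos_of_mul_pos_right (a := -(18 * b * (b + 1) ^ 3)) ?_ hK.le
    unfold conic at h
    nlinarith [sq_nonneg (3 * (b + 1) ^ 2 * x - 2 * mixed b δ * z)]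
  have hdisc := mul_neg_of_neg_of_pos (mixed_neg h₀ h₁ hb) (derivForm_discrim_pos h₀ h₁ hb)
  have hform := quadratic_form_pos (a := 3 * derivXSq b δ)
    (e := 12 * mixed b δ * derivXY b δ)
    (c := mixed b δ * ySq b δ * (ySq b δ - 18 * (b + 1) ^ 3))
    (by linarith [derivXSq_pos h₀ h₁ hb]) (by linarith) ((b + 1) ^ 2 * x) hz
  have hneg : 12 * b * (b + 1) ^ 2 * z < 0 := by
    have := mul_pos (mul_pos (neg_pos.2 hb0) (pow_pos hs 2)) hz0
    linarith
  refine neg_of_mul_neg_right (a := (18 * b * (b + 1) ^ 3) ^ 2) ?_ (sq_nonneg _)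
  rw [flowDeriv_eq_of_conic_eq_zero hz h]
  exact mul_neg_of_neg_of_pos hneg hform

end

end ExteriorEllipse


/-- For `δ ∈ (0, 647/1000]`, the exterior conic constructed by the paper's method
for the quadratic system `ẋ = δx + x² - y, ẏ = x(1+x+y)` is a nonempty bounded
curve (an ellipse) which is transversal: its derivative along the flow does not
take both strictly positive and strictly negative values on the curve, and
vanishes at only finitely many of its points. -/
theorem exterior_ellipse_transversal_quadratic
    (δ b₀ D : ℝ) (N Ndot P Q : ℝ × ℝ → ℝ)
    (hδ0 : 0 < δ) (hδ1 : δ ≤ 647 / 1000)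
    (hb₀ : b₀ = -(43 * δ + 57) / 200)
    (hD : D = b₀ ^ 2 * (2 * b₀ ^ 2 * δ ^ 2 - 14 * b₀ ^ 2 * δ - 25 * b₀ ^ 2
      + 4 * b₀ * δ ^ 2 - 14 * b₀ * δ - 18 * b₀ + 2 * δ ^ 2 - 9))
    (hN : ∀ x y : ℝ, N (x, y) =
      D + 9 * (b₀ + 1) ^ 4 * x ^ 2
        - 12 * (b₀ + 1) ^ 2 * (b₀ * δ + b₀ + δ) * x * y
        + (18 * b₀ ^ 3 + 2 * b₀ ^ 2 * δ ^ 2 - 14 * b₀ ^ 2 * δ + 29 * b₀ ^ 2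
            + 4 * b₀ * δ ^ 2 - 14 * b₀ * δ + 36 * b₀ + 2 * δ ^ 2 + 9) * y ^ 2
        + 12 * b₀ * (b₀ + 1) ^ 2 * (b₀ * δ + b₀ + δ) * x
        - 2 * b₀ * (9 * b₀ ^ 3 + 2 * b₀ ^ 2 * δ ^ 2 - 14 * b₀ ^ 2 * δ + 2 * b₀ ^ 2
            + 4 * b₀ * δ ^ 2 - 14 * b₀ * δ + 9 * b₀ + 2 * δ ^ 2) * y)
    (hP : ∀ x y : ℝ, P (x, y) = δ * x + x ^ 2 - y)
    (hQ : ∀ x y : ℝ, Q (x, y) = x * (1 + x + y))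
    (hNdot : ∀ p : ℝ × ℝ,
      Ndot p = P p * fderiv ℝ N p (1, 0) + Q p * fderiv ℝ N p (0, 1)) :
    ({p : ℝ × ℝ | N p = 0}).Nonempty ∧
    Bornology.IsBounded {p : ℝ × ℝ | N p = 0} ∧
    ¬ ((∃ p : ℝ × ℝ, N p = 0 ∧ 0 < Ndot p) ∧ (∃ p : ℝ × ℝ, N p = 0 ∧ Ndot p < 0)) ∧
    Set.Finite {p : ℝ × ℝ | N p = 0 ∧ Ndot p = 0} := by
  have hs : b₀ + 1 ≠ 0 := by intro h; linarith
  have hconic : ∀ x y, N (x, y) = ExteriorEllipse.conic b₀ δ x (y - b₀) := fun x y ↦ by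
    rw [hN, hD]
    unfold ExteriorEllipse.conic ExteriorEllipse.mixed ExteriorEllipse.ySq
    ring
  have hflow : ∀ x y, Ndot (x, y) = ExteriorEllipse.flowDeriv b₀ δ x (y - b₀) := fun x y ↦ by
    have hNfun : N = fun q : ℝ × ℝ ↦
        (ExteriorEllipse.ySq b₀ δ * b₀ ^ 2 - 18 * b₀ * (b₀ + 1) ^ 3 * b₀)
          + 9 * (b₀ + 1) ^ 4 * q.1 ^ 2
          + -12 * (b₀ + 1) ^ 2 * ExteriorEllipse.mixed b₀ δ * (q.1 * q.2)
          + ExteriorEllipse.ySq b₀ δ * q.2 ^ 2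
          + 12 * b₀ * (b₀ + 1) ^ 2 * ExteriorEllipse.mixed b₀ δ * q.1
          + (18 * b₀ * (b₀ + 1) ^ 3 - 2 * b₀ * ExteriorEllipse.ySq b₀ δ) * q.2 := by
      ext ⟨u, v⟩
      rw [hconic]
      unfold ExteriorEllipse.conic
      ring
    rw [hNdot, hP, hQ, hNfun, fderiv_quadratic_apply, fderiv_quadratic_apply]
    unfold ExteriorEllipse.flowDeriv
    ring
  have hneg : ∀ x y, N (x, y) = 0 → (x, y) ≠ (0, b₀) → Ndot (x, y) < 0 := fun x y h hne ↦ by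
    rw [hflow]
    rw [hconic] at h
    refine ExteriorEllipse.flowDeriv_neg hδ0 hδ1 hb₀ h fun hz ↦ hne ?_
    have hx : 9 * (b₀ + 1) ^ 4 * x ^ 2 = 0 := by simpa [hz, ExteriorEllipse.conic] using h
    have hx0 : x = 0 := by simpa [hs] using hx
    rw [hx0, sub_eq_zero.1 hz]
  have hcontact : Ndot (0, b₀) = 0 := by
    rw [hflow]
    unfold ExteriorEllipse.flowDeriv
    ring
  refine ⟨⟨(0, b₀), ?_⟩, ?_, ?_, ?_⟩
  · change N (0, b₀) = 0
    rw [hconic]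
    unfold ExteriorEllipse.conic
    ring
  · refine (isBounded_setOf_sq_add_eq (α := 3 * (b₀ + 1) ^ 2)
      (2 * ExteriorEllipse.mixed b₀ δ) (-18 * b₀ * (b₀ + 1) ^ 3) b₀ (by positivity)
      (ExteriorEllipse.ySq_sub_pos hδ0 hδ1 hb₀)).subset ?_
    rintro ⟨x, y⟩ h
    have h' : ExteriorEllipse.conic b₀ δ x (y - b₀) = 0 := (hconic x y).symm.trans h
    unfold ExteriorEllipse.conic at h'
    simp only [Set.mem_ofPred_eq]
    linear_combination h'
  · rintro ⟨⟨⟨x, y⟩, h, hpos⟩, -⟩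
    rcases eq_or_ne (x, y) (0, b₀) with hp | hp
    · rw [hp, hcontact] at hpos
      exact hpos.false
    · exact hpos.not_gt (hneg x y h hp)
  · refine (Set.finite_singleton (0, b₀)).subset ?_
    rintro ⟨x, y⟩ ⟨h, hzero⟩
    by_contra hp
    exact (hneg x y h hp).ne hzero
end

section
/- Consider the system ẋ = δx + x²/7 − y, ẏ = x(1 + x/3 + y/5) and set δ₁ = 2√(5/7) − 5/3. If 0 < δ < δ₁, then (0,0) is the only point (x,y) ∈ ℝ² satisfying δx + x²/7 − y = 0 and x(1 + x/3 + y/5) = 0. If δ > δ₁, then this pair of equations has exactly three solutions in ℝ². -/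
/-- The singular points of the quadratic system are the points of the parabola `y = δx + x²/7`
whose abscissa is zero or a root of a quadratic polynomial. -/
lemma quadratic_system_singular_iff (δ x y : ℝ) :
    (δ * x + x ^ 2 / 7 - y = 0 ∧ x * (1 + x / 3 + y / 5) = 0) ↔
      y = δ * x + x ^ 2 / 7 ∧ (x = 0 ∨ x ^ 2 + 7 * (δ + 5 / 3) * x + 35 = 0) := by
  rw [sub_eq_zero, eq_comm, mul_eq_zero]
  refine and_congr_right fun h ↦ or_congr_right ?_
  rw [h]
  constructor <;> intro h' <;> linarith

/-- For the system `ẋ = δx + x²/7 - y, ẏ = x(1 + x/3 + y/5)` with `δ > 0` and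
`δ₁ = 2√(5/7) - 5/3`: if `0 < δ < δ₁` the origin is the only singular point,
while if `δ > δ₁` there are exactly three singular points. -/
theorem singular_points_quadratic_example
    (δ : ℝ) (hδ : 0 < δ) :
    (δ < 2 * Real.sqrt (5 / 7) - 5 / 3 →
      {p : ℝ × ℝ | δ * p.1 + p.1 ^ 2 / 7 - p.2 = 0 ∧
        p.1 * (1 + p.1 / 3 + p.2 / 5) = 0} = {(0, 0)}) ∧
    (2 * Real.sqrt (5 / 7) - 5 / 3 < δ →
      ({p : ℝ × ℝ | δ * p.1 + p.1 ^ 2 / 7 - p.2 = 0 ∧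
        p.1 * (1 + p.1 / 3 + p.2 / 5) = 0}).encard = 3) := by
  have hr : Real.sqrt (5 / 7) ^ 2 = 5 / 7 := Real.sq_sqrt (by norm_num)
  have hr0 : 0 ≤ Real.sqrt (5 / 7) := Real.sqrt_nonneg _
  simp only [quadratic_system_singular_iff]
  constructor
  · intro h
    have hD : (7 * (δ + 5 / 3)) ^ 2 < 140 := by nlinarith
    ext ⟨x, y⟩
    simp only [Set.mem_ofPred_eq, Set.mem_singleton_iff, Prod.mk.injEq]
    constructor
    · rintro ⟨rfl, rfl | hx⟩
      · simp
      · nlinarith [sq_nonneg (2 * x + 7 * (δ + 5 / 3))]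
    · rintro ⟨rfl, rfl⟩
      simp
  · intro h
    have hD : 0 < (7 * (δ + 5 / 3)) ^ 2 - 140 := by nlinarith
    set m := 7 * (δ + 5 / 3) with hm
    obtain ⟨s, hs, hs2⟩ : ∃ s : ℝ, 0 < s ∧ s ^ 2 = m ^ 2 - 140 :=
      ⟨_, Real.sqrt_pos.2 hD, Real.sq_sqrt hD.le⟩
    have hroot (x : ℝ) : x ^ 2 + m * x + 35 = 0 ↔ x = (-m + s) / 2 ∨ x = (-m - s) / 2 := by
      have hfac : x ^ 2 + m * x + 35 = (x - (-m + s) / 2) * (x - (-m - s) / 2) := by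
        linear_combination hs2 / 4
      rw [hfac, mul_eq_zero, sub_eq_zero, sub_eq_zero]
    have himage : {p : ℝ × ℝ | p.2 = δ * p.1 + p.1 ^ 2 / 7 ∧
        (p.1 = 0 ∨ p.1 ^ 2 + m * p.1 + 35 = 0)} =
        (fun x : ℝ ↦ (x, δ * x + x ^ 2 / 7)) '' {0, (-m + s) / 2, (-m - s) / 2} := by
      ext ⟨x, y⟩
      simp only [Set.mem_ofPred_eq, hroot, Set.mem_image, Set.mem_insert_iff,
        Set.mem_singleton_iff, Prod.mk.injEq]
      constructor
      · rintro ⟨hy, hx⟩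
        exact ⟨x, hx, rfl, hy.symm⟩
      · rintro ⟨_, hx, rfl, hy⟩
        exact ⟨hy.symm, hx⟩
    have hinj : Function.Injective fun x : ℝ ↦ (x, δ * x + x ^ 2 / 7) :=
      fun _ _ h ↦ congrArg Prod.fst h
    rw [himage, hinj.encard_image, Set.encard_eq_three]
    refine ⟨_, _, _, ?_, ?_, ?_, rfl⟩
    · intro h0
      nlinarith
    · intro h0
      nlinarith
    · intro h0
      linarith
end

section
/- Let 0 < ε ≤ 1/6 and a₀ = (6/ε)^{1/3}, and define f(x,y) = 1 − x²/a₀² − 2(3 − a₀²)ε x y/(3a₀²) + (−9 − 9ε² + a₀⁴ε²)y²/(9a₀²). With P(x,y) = y − ε(x³/3 − x), Q(x,y) = −x, and ḟ = P·∂f/∂x + Q·∂f/∂y, the set C = {(x,y) ∈ ℝ² : f(x,y) = 0} is nonempty and bounded (an ellipse), ḟ does not take both strictly positive and strictly negative values on C, and {p ∈ C : ḟ(p) = 0} is finite. -/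
/-- A binary quadratic form with positive leading coefficient and negative discriminant is
positive away from the origin. -/
theorem quadratic_form_pos_s9 {A M N : ℝ} (hA : 0 < A) (hD : M ^ 2 < A * N) {X y : ℝ}
    (h : X ≠ 0 ∨ y ≠ 0) : 0 < A * X ^ 2 - 2 * M * X * y + N * y ^ 2 := by
  have key : A * (A * X ^ 2 - 2 * M * X * y + N * y ^ 2)
      = (A * X - M * y) ^ 2 + (A * N - M ^ 2) * y ^ 2 := by ring
  refine pos_of_mul_pos_right (a := A) ?_ hA.le
  rw [key]
  by_cases hy : y = 0
  · have hX : X ≠ 0 := h.resolve_right (not_not.mpr hy)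
    subst hy
    have : 0 < (A * X) ^ 2 := by positivity
    linarith
  · have : 0 < (A * N - M ^ 2) * y ^ 2 := mul_pos (sub_pos.mpr hD) (by positivity)
    positivity

theorem discriminant_neg {u : ℝ} (h0 : 0 < u) (h1 : u ≤ 0.092) :
    ((1 - 3 * u) * (3 - 10 * u + 36 * u ^ 3)) ^ 2
      < (9 - 48 * u + 36 * u ^ 2) * ((1 - 3 * u) * (1 - 4 * u + 36 * u ^ 3)) := by
  have hw : 0 < 1 - 3 * u := by linarith
  have h2 : u ^ 2 ≤ 0.092 ^ 2 := pow_le_pow_left₀ h0.le h1 2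
  have h3 : u ^ 3 ≤ 0.092 ^ 3 := pow_le_pow_left₀ h0.le h1 3
  have hc : 222 ≤ 264 - 360 * u - 864 * u ^ 2 - 1296 * u ^ 3 := by linarith
  have hq : 0 < 3 - 52 * u + 222 * u ^ 2 := by nlinarith
  have hm := mul_le_mul_of_nonneg_left hc (sq_nonneg u)
  have hD : 0 < 3 - 52 * u + 264 * u ^ 2 - 360 * u ^ 3 - 864 * u ^ 4 - 1296 * u ^ 5
      + 3888 * u ^ 6 := by
    have : 0 < u ^ 6 := by positivity
    nlinarith
  have := mul_pos (mul_pos hw h0) hD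
  linarith

/-- The partial derivatives of a binary quadratic polynomial. -/
theorem hasFDerivAt_quadratic (r b c : ℝ) (p : ℝ × ℝ) :
    HasFDerivAt (fun p : ℝ × ℝ => 1 - r * (p.1 ^ 2 - 2 * b * (p.1 * p.2) + c * p.2 ^ 2))
      ((-r * (2 * p.1 - 2 * b * p.2)) • ContinuousLinearMap.fst ℝ ℝ ℝ
        + (-r * (2 * c * p.2 - 2 * b * p.1)) • ContinuousLinearMap.snd ℝ ℝ ℝ) p := by
  have hx : HasFDerivAt (fun p : ℝ × ℝ => p.1) (ContinuousLinearMap.fst ℝ ℝ ℝ) p :=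
    hasFDerivAt_fst
  have hy : HasFDerivAt (fun p : ℝ × ℝ => p.2) (ContinuousLinearMap.snd ℝ ℝ ℝ) p :=
    hasFDerivAt_snd
  refine (((((hx.pow 2).sub ((hx.mul hy).const_mul (2 * b))).add
    ((hy.pow 2).const_mul c)).const_mul r).const_sub 1).congr_fderiv ?_
  ext <;> simp
  ring


/-- The exterior conic constructed by the paper's method for the van der Pol
system `ẋ = y - ε(x³/3 - x), ẏ = -x` is a nonempty bounded curve (an ellipse)
which is transversal: `ḟ` does not take both strictly positive and strictly
negative values on the curve, and vanishes at only finitely many of its points. -/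
theorem vanderPol_exterior_ellipse_transversal_9
    (ε a₀ : ℝ) (hε0 : 0 < ε) (hε1 : ε ≤ 1 / 6)
    (ha₀ : a₀ = (6 / ε) ^ ((1 : ℝ) / 3))
    (f fdot P Q : ℝ × ℝ → ℝ)
    (hf : ∀ x y : ℝ, f (x, y) =
      1 - x ^ 2 / a₀ ^ 2 - 2 * (3 - a₀ ^ 2) * ε * x * y / (3 * a₀ ^ 2)
        + (-9 - 9 * ε ^ 2 + a₀ ^ 4 * ε ^ 2) * y ^ 2 / (9 * a₀ ^ 2))
    (hP : ∀ x y : ℝ, P (x, y) = y - ε * (x ^ 3 / 3 - x))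
    (hQ : ∀ x y : ℝ, Q (x, y) = -x)
    (hfdot : ∀ p : ℝ × ℝ,
      fdot p = P p * fderiv ℝ f p (1, 0) + Q p * fderiv ℝ f p (0, 1)) :
    ({p : ℝ × ℝ | f p = 0}).Nonempty ∧
    Bornology.IsBounded {p : ℝ × ℝ | f p = 0} ∧
    ¬ ((∃ p : ℝ × ℝ, f p = 0 ∧ 0 < fdot p) ∧ (∃ p : ℝ × ℝ, f p = 0 ∧ fdot p < 0)) ∧
    Set.Finite {p : ℝ × ℝ | f p = 0 ∧ fdot p = 0} := by
  have ha : 0 < a₀ := ha₀ ▸ Real.rpow_pos_of_pos (by positivity) _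
  have ha3 : a₀ ^ 3 = 6 / ε := by
    rw [ha₀, ← Real.rpow_natCast, ← Real.rpow_mul (by positivity)]
    norm_num
  obtain ⟨v, hv⟩ : ∃ v, v = a₀⁻¹ := ⟨_, rfl⟩
  have hv0 : 0 < v := hv ▸ inv_pos.mpr ha
  have hav : a₀ = v⁻¹ := by rw [hv, inv_inv]
  have hε : ε = 6 * v ^ 3 := by
    rw [hv, inv_pow, ha3]
    field_simp
  have hu0 : 0 < v ^ 2 := by positivity
  have hu1 : v ^ 2 ≤ 0.092 := by
    have h3 : v ^ 3 ≤ 0.303 ^ 3 := by linarith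
    have h1 : v ≤ 0.303 := le_of_pow_le_pow_left₀ three_ne_zero (by norm_num) h3
    nlinarith
  obtain ⟨b, hb⟩ : ∃ b, b = 2 * v * (1 - 3 * v ^ 2) := ⟨_, rfl⟩
  obtain ⟨c, hc⟩ : ∃ c, c = 1 - 4 * v ^ 2 + 36 * v ^ 6 := ⟨_, rfl⟩
  have hfun : f = fun p : ℝ × ℝ =>
      1 - v ^ 2 * (p.1 ^ 2 - 2 * b * (p.1 * p.2) + c * p.2 ^ 2) := by
    funext ⟨x, y⟩
    rw [hf, hb, hc, hε, hav]
    field_simp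
    ring
  have hfxy (x y : ℝ) : f (x, y) = 1 - v ^ 2 * (x ^ 2 - 2 * b * (x * y) + c * y ^ 2) := by
    rw [hfun]
  have hdot (x y : ℝ) (h : f (x, y) = 0) : fdot (x, y) = 4 * v ^ 5 * y ^ 2 *
      ((9 - 48 * v ^ 2 + 36 * (v ^ 2) ^ 2) * (v * x) ^ 2
        - 2 * ((1 - 3 * v ^ 2) * (3 - 10 * v ^ 2 + 36 * (v ^ 2) ^ 3)) * (v * x) * y
        + ((1 - 3 * v ^ 2) * (1 - 4 * v ^ 2 + 36 * (v ^ 2) ^ 3)) * y ^ 2) := by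
    rw [hfxy] at h
    rw [hfdot, hP, hQ, hfun, (hasFDerivAt_quadratic (v ^ 2) b c (x, y)).fderiv]
    simp only [add_apply, smul_apply,
      ContinuousLinearMap.coe_fst',
      ContinuousLinearMap.coe_snd', smul_eq_mul]
    rw [hc, hb] at h ⊢
    rw [hε]
    linear_combination 2 * v ^ 2 * (-2 * v * x ^ 2 - 2 * v * (2 * v * (1 - 3 * v ^ 2)) * x * y
      + 2 * v * (1 - 3 * v ^ 2) * y ^ 2) * h
  have hpos (x y : ℝ) (h : f (x, y) = 0) :
      0 < (9 - 48 * v ^ 2 + 36 * (v ^ 2) ^ 2) * (v * x) ^ 2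
        - 2 * ((1 - 3 * v ^ 2) * (3 - 10 * v ^ 2 + 36 * (v ^ 2) ^ 3)) * (v * x) * y
        + ((1 - 3 * v ^ 2) * (1 - 4 * v ^ 2 + 36 * (v ^ 2) ^ 3)) * y ^ 2 := by
    refine quadratic_form_pos_s9 (by nlinarith) (discriminant_neg hu0 hu1) ?_
    by_contra! hxy
    obtain ⟨hx, rfl⟩ := hxy
    obtain rfl : x = 0 := by simpa [hv0.ne'] using hx
    simp [hfxy] at h
  have hnonneg (p : ℝ × ℝ) (h : f p = 0) : 0 ≤ fdot p := by
    obtain ⟨x, y⟩ := p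
    rw [hdot x y h]
    have := hpos x y h
    positivity
  refine ⟨⟨(a₀, 0), ?_⟩, ?_, ?_, ?_⟩
  · rw [Set.mem_ofPred_eq, hfxy, hav]
    field_simp
    ring
  · refine (Metric.isBounded_closedBall (x := (0 : ℝ × ℝ)) (r := 3 * a₀)).subset ?_
    rintro ⟨x, y⟩ h
    rw [Set.mem_ofPred_eq, hfxy] at h
    have he : (x - b * y) ^ 2 + (c - b ^ 2) * y ^ 2 = a₀ ^ 2 := by
      rw [hav]
      field_simp
      linear_combination -h
    have hcb : 1 / 3 ≤ c - b ^ 2 := by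
      rw [hc, hb]
      nlinarith [sq_nonneg (v ^ 2)]
    have hb2 : b ^ 2 ≤ 0.368 := by
      have hw : (1 - 3 * v ^ 2) ^ 2 ≤ 1 := by nlinarith
      have : b ^ 2 = 4 * v ^ 2 * (1 - 3 * v ^ 2) ^ 2 := by rw [hb]; ring
      nlinarith
    have hy : y ^ 2 ≤ 3 * a₀ ^ 2 := by
      nlinarith [mul_le_mul_of_nonneg_right hcb (sq_nonneg y), sq_nonneg (x - b * y)]
    have hx : x ^ 2 ≤ 9 * a₀ ^ 2 := by
      nlinarith [mul_le_mul_of_nonneg_right hcb (sq_nonneg y),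
        mul_le_mul_of_nonneg_right hb2 (sq_nonneg y), sq_nonneg (x - 2 * (b * y)),
        sq_nonneg y]
    rw [mem_closedBall_zero_iff, Prod.norm_def, max_le_iff, Real.norm_eq_abs, Real.norm_eq_abs]
    exact ⟨abs_le_of_sq_le_sq (by linarith) (by positivity),
      abs_le_of_sq_le_sq (by nlinarith) (by positivity)⟩
  · rintro ⟨-, p, hp, hlt⟩
    exact (hnonneg p hp).not_gt hlt
  · refine (Set.toFinite {(a₀, 0), (-a₀, 0)}).subset ?_
    rintro ⟨x, y⟩ ⟨h, h0⟩
    rw [hdot x y h] at h0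
    obtain rfl : y = 0 := by
      simpa [hv0.ne', (hpos x y h).ne'] using h0
    have hx : x ^ 2 = a₀ ^ 2 := by
      rw [hfxy] at h
      rw [hav]
      field_simp
      linear_combination -h
    rcases sq_eq_sq_iff_eq_or_eq_neg.mp hx with rfl | rfl <;> simp
end

section
/- Let ε ≥ 8/5 and a₀ = √3 + (√3/4)·ε⁻² − (17/(32√3))·ε⁻⁴ + (1/36)·ε⁻⁵ + (1/5)·ε⁻⁶, and define f(x,y) = 1 − x²/a₀² − 2(3 − a₀²)ε x y/(3a₀²) + (−9 − 9ε² + a₀⁴ε²)y²/(9a₀²). With P(x,y) = y − ε(x³/3 − x), Q(x,y) = −x, and ḟ = P·∂f/∂x + Q·∂f/∂y, the set C = {(x,y) ∈ ℝ² : f(x,y) = 0} is nonempty and bounded (an ellipse), ḟ does not take both strictly positive and strictly negative values on C, and {p ∈ C : ḟ(p) = 0} is finite. -/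
/-- Gradient data of a planar quadratic form plus a constant. -/
lemma fderiv_quadratic_form (k a b c : ℝ) (f : ℝ × ℝ → ℝ)
    (hf : ∀ x y : ℝ, f (x, y) = k + a * x ^ 2 + b * (x * y) + c * y ^ 2) (x y : ℝ) :
    fderiv ℝ f (x, y) (1, 0) = 2 * a * x + b * y ∧
      fderiv ℝ f (x, y) (0, 1) = b * x + 2 * c * y := by
  have hfun : f = fun p : ℝ × ℝ => k + a * p.1 ^ 2 + b * (p.1 * p.2) + c * p.2 ^ 2 := by
    funext p
    exact hf p.1 p.2
  have h1 : HasFDerivAt (fun p : ℝ × ℝ => p.1) (ContinuousLinearMap.fst ℝ ℝ ℝ) (x, y) :=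
    hasFDerivAt_fst
  have h2 : HasFDerivAt (fun p : ℝ × ℝ => p.2) (ContinuousLinearMap.snd ℝ ℝ ℝ) (x, y) :=
    hasFDerivAt_snd
  have h := ((((h1.pow 2).const_mul a).const_add k).add ((h1.mul h2).const_mul b)).add
    ((h2.pow 2).const_mul c)
  rw [hfun]
  erw [h.fderiv]
  constructor
  · simp
    ring
  · simp
    ring

/-- A binary quadratic form with negative second diagonal coefficient and negative discriminant
is negative definite. -/
lemma quadratic_form_neg {α β γ x y : ℝ} (hγ : γ < 0) (hdisc : β ^ 2 < 4 * α * γ)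
    (hxy : x ≠ 0 ∨ y ≠ 0) : α * x ^ 2 + β * (x * y) + γ * y ^ 2 < 0 := by
  have hpos : 0 < (2 * γ * y + β * x) ^ 2 + (4 * α * γ - β ^ 2) * x ^ 2 := by
    by_cases hx : x = 0
    · have hy : y ≠ 0 := hxy.resolve_left (not_not_intro hx)
      subst hx
      have : 0 < (2 * γ * y) ^ 2 := by
        have : 2 * γ * y ≠ 0 := mul_ne_zero (by linarith) hy
        positivity
      nlinarith
    · have : 0 < x ^ 2 := by positivity
      have := mul_pos (sub_pos.2 hdisc) this
      positivity
  by_contra! hcon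
  nlinarith [mul_nonneg hcon (neg_nonneg.2 hγ.le)]

/-- The discriminant governing transversality factors through `σ`, where `σ ^ 2` is the
discriminant of the conic. -/
lemma discriminant_pos_of_sigma {A β C σ t : ℝ} (hA : 0 < A) (ht : 0 < t)
    (hσ : σ ^ 2 = 9 - 2 * A * β) (hC : t ^ 2 * C = σ ^ 2 + t ^ 2 * β ^ 2)
    (hlow : t ^ 2 * ((9 - σ ^ 2) * (3 - σ) ^ 3) < 4 * A ^ 2 * σ ^ 2 * (9 - σ))
    (hup : 4 * A ^ 2 * σ ^ 2 * (9 + σ) < t ^ 2 * ((9 - σ ^ 2) * (3 + σ) ^ 3)) :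
    β * (A * C + 18 * β) ^ 2 < 36 * C * (2 * A * β ^ 2 + 9 * β - A * C) := by
  have hβ : β = (9 - σ ^ 2) / (2 * A) := by
    field_simp
    linarith
  have hC' : C = σ ^ 2 / t ^ 2 + β ^ 2 := by
    field_simp
    linarith
  have key : 32 * A ^ 3 * t ^ 4 *
      (36 * C * (2 * A * β ^ 2 + 9 * β - A * C) - β * (A * C + 18 * β) ^ 2) =
      (4 * A ^ 2 * σ ^ 2 * (9 - σ) - t ^ 2 * ((9 - σ ^ 2) * (3 - σ) ^ 3)) *
      (t ^ 2 * ((9 - σ ^ 2) * (3 + σ) ^ 3) - 4 * A ^ 2 * σ ^ 2 * (9 + σ)) := by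
    rw [hC', hβ]
    field_simp
    ring
  have hprod := mul_pos (sub_pos.2 hlow) (sub_pos.2 hup)
  rw [← key] at hprod
  have h32 : 0 < 32 * A ^ 3 * t ^ 4 := by positivity
  exact sub_pos.1 ((mul_pos_iff_of_pos_left h32).1 hprod)

/-- Two-sided polynomial bounds for the normalized squared semi-axis `β = (a₀² - 3) ε²`. -/
lemma beta_bounds {r t β : ℝ} (hr1 : 173 / 100 ≤ r) (hr2 : r ≤ 17321 / 10000)
    (ht0 : 0 < t) (ht : t ≤ 5 / 8)
    (hβ : β = 3 / 2 - 7 / 8 * t ^ 2 - 17 / 64 * t ^ 4 + 289 / 3072 * t ^ 6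
      + 2 * r * t ^ 3 * (1 / 36 + t / 5) * (1 + t ^ 2 / 4 - 17 / 96 * t ^ 4)
      + t ^ 8 * (1 / 36 + t / 5) ^ 2) :
    3 / 2 - 7 / 8 * t ^ 2 + r / 18 * t ^ 3 + t ^ 4 * (425 / 1000 + t / 50 + 21 / 100 * t ^ 2)
      ≤ β ∧
    β ≤ 3 / 2 - 7 / 8 * t ^ 2 + r / 18 * t ^ 3 + t ^ 4 * (44 / 100 + 24 / 100 * t ^ 2) := by
  have ht' : 0 ≤ 5 / 8 - t := by linarith
  have hr1' : 0 ≤ r - 173 / 100 := by linarith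
  have hr2' : 0 ≤ 17321 / 10000 - r := by linarith
  have hw : β = 3 / 2 - 7 / 8 * t ^ 2 + r / 18 * t ^ 3 + t ^ 4 * (2 / 5 * r - 17 / 64 + r / 72 * t
      + (289 / 3072 + r / 10) * t ^ 2 - 17 / 1728 * r * t ^ 3 + (1 / 1296 - 17 / 240 * r) * t ^ 4
      + t ^ 5 / 90 + t ^ 6 / 25) := by
    rw [hβ]; ring
  have h4 : 0 ≤ t ^ 4 := by positivity
  have b (i j : ℕ) : 0 ≤ t ^ i * (5 / 8 - t) ^ j := by positivity
  have r1 (i : ℕ) : 0 ≤ (r - 173 / 100) * t ^ i := by positivity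
  have r2 (i : ℕ) : 0 ≤ (17321 / 10000 - r) * t ^ i := by positivity
  rw [hw]
  constructor
  · refine add_le_add le_rfl (mul_le_mul_of_nonneg_left ?_ h4)
    linarith [r1 0, r1 1, r1 2, r2 3, r2 4, b 0 6, b 1 5, b 2 4, b 3 3, b 4 2, b 5 1, b 6 0]
  · refine add_le_add le_rfl (mul_le_mul_of_nonneg_left ?_ h4)
    linarith [r2 0, r2 1, r2 2, r1 3, r1 4, b 0 6, b 1 5, b 2 4, b 3 3, b 4 2, b 5 1, b 6 0]

/-- Bounds for the discriminant of the conic. -/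
lemma conic_disc_bounds {r t β : ℝ} (hr : r ^ 2 = 3) (hr1 : 173 / 100 ≤ r)
    (hr2 : r ≤ 17321 / 10000) (ht0 : 0 < t) (ht : t ≤ 5 / 8)
    (hβ1 : 3 / 2 - 7 / 8 * t ^ 2 + r / 18 * t ^ 3
      + t ^ 4 * (425 / 1000 + t / 50 + 21 / 100 * t ^ 2) ≤ β)
    (hβ2 : β ≤ 3 / 2 - 7 / 8 * t ^ 2 + r / 18 * t ^ 3 + t ^ 4 * (44 / 100 + 24 / 100 * t ^ 2)) :
    (t * (r / 2 - t / 3)) ^ 2 ≤ 9 - 2 * (3 + t ^ 2 * β) * β ∧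
    9 - 2 * (3 + t ^ 2 * β) * β ≤ t ^ 2 * (3 / 4 + 2 / 5 * t - 19 / 25 * t ^ 2) := by
  have ht' : 0 ≤ 5 / 8 - t := by linarith
  have hr0 : 0 ≤ r := by linarith
  have hr1' : 0 ≤ r - 173 / 100 := by linarith
  have hr2' : 0 ≤ 17321 / 10000 - r := by linarith
  have h4 : 0 ≤ t ^ 4 := by positivity
  have b (i j : ℕ) : 0 ≤ t ^ i * (5 / 8 - t) ^ j := by positivity
  have r1 (i : ℕ) : 0 ≤ (r - 173 / 100) * t ^ i := by positivity
  have r2 (i : ℕ) : 0 ≤ (17321 / 10000 - r) * t ^ i := by positivity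
  have expand (w : ℝ) :
      9 - 2 * (3 + t ^ 2 * (3 / 2 - 7 / 8 * t ^ 2 + r / 18 * t ^ 3 + t ^ 4 * w)) *
        (3 / 2 - 7 / 8 * t ^ 2 + r / 18 * t ^ 3 + t ^ 4 * w) =
      t ^ 2 * (3 / 4 - r / 3 * t) + t ^ 4 * (21 / 4 - 6 * w - r / 3 * t - (49 / 32 + 6 * w) * t ^ 2
        + 7 / 36 * r * t ^ 3 - (1 / 54 - 7 / 2 * w) * t ^ 4 - 2 / 9 * r * w * t ^ 5
        - 2 * w ^ 2 * t ^ 6) := by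
    linear_combination (-t ^ 8 / 162) * hr
  have mono {x y : ℝ} (hx : 0 ≤ x) (hxy : x ≤ y) :
      9 - 2 * (3 + t ^ 2 * y) * y ≤ 9 - 2 * (3 + t ^ 2 * x) * x := by
    have : (3 + t ^ 2 * x) * x ≤ (3 + t ^ 2 * y) * y := by
      have hy := hx.trans hxy
      gcongr
    linarith
  have hlow : 0 ≤ 3 / 2 - 7 / 8 * t ^ 2 + r / 18 * t ^ 3
      + t ^ 4 * (425 / 1000 + t / 50 + 21 / 100 * t ^ 2) := by
    have : 0 ≤ 3 / 2 - 7 / 8 * t ^ 2 := by nlinarith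
    positivity
  constructor
  · refine le_trans ?_ (mono (hlow.trans hβ1) hβ2)
    rw [expand]
    have hG : 0 ≤ 21 / 4 - 1 / 9 - 6 * (44 / 100 + 24 / 100 * t ^ 2) - r / 3 * t
        - (49 / 32 + 6 * (44 / 100 + 24 / 100 * t ^ 2)) * t ^ 2
        + 7 / 36 * r * t ^ 3 - (1 / 54 - 7 / 2 * (44 / 100 + 24 / 100 * t ^ 2)) * t ^ 4
        - 2 / 9 * r * (44 / 100 + 24 / 100 * t ^ 2) * t ^ 5
        - 2 * (44 / 100 + 24 / 100 * t ^ 2) ^ 2 * t ^ 6 := by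
      linarith [r2 1, r1 3, r2 5, r2 7, b 0 10, b 1 9, b 2 8, b 3 7, b 4 6, b 5 5, b 6 4, b 7 3,
        b 8 2, b 9 1, b 10 0]
    have := mul_nonneg h4 hG
    linear_combination this + t ^ 2 / 4 * hr
  · refine (mono hlow hβ1).trans ?_
    rw [expand]
    have hG : 0 ≤ 2 / 5 - 19 / 25 * t + r / 3
        - t * (21 / 4 - 6 * (425 / 1000 + t / 50 + 21 / 100 * t ^ 2) - r / 3 * t
        - (49 / 32 + 6 * (425 / 1000 + t / 50 + 21 / 100 * t ^ 2)) * t ^ 2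
        + 7 / 36 * r * t ^ 3 - (1 / 54 - 7 / 2 * (425 / 1000 + t / 50 + 21 / 100 * t ^ 2)) * t ^ 4
        - 2 / 9 * r * (425 / 1000 + t / 50 + 21 / 100 * t ^ 2) * t ^ 5
        - 2 * (425 / 1000 + t / 50 + 21 / 100 * t ^ 2) ^ 2 * t ^ 6) := by
      rcases le_total t (2 / 5) with h | h
      · have h' : 0 ≤ 2 / 5 - t := by linarith
        have c (i j : ℕ) : 0 ≤ t ^ i * (2 / 5 - t) ^ j := by positivity
        linarith [r1 0, r1 2, r2 4, r1 6, r1 7, r1 8, c 0 11, c 1 10, c 2 9, c 3 8, c 4 7, c 5 6,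
          c 6 5, c 7 4, c 8 3, c 9 2, c 10 1, c 11 0]
      · have h' : 0 ≤ t - 2 / 5 := by linarith
        have c (i j : ℕ) : 0 ≤ (t - 2 / 5) ^ i * (5 / 8 - t) ^ j := by positivity
        linarith [r1 0, r1 2, r2 4, r1 6, r1 7, r1 8, c 0 11, c 1 10, c 2 9, c 3 8, c 4 7, c 5 6,
          c 6 5, c 7 4, c 8 3, c 9 2, c 10 1, c 11 0]
    have := mul_nonneg (pow_pos ht0 3).le hG
    linear_combination this

/-- The lower sign condition in the factored discriminant. -/
lemma sigma_lower {r t A σ : ℝ} (hr : r ^ 2 = 3) (hr1 : 173 / 100 ≤ r)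
    (ht0 : 0 < t) (ht : t ≤ 5 / 8)
    (hA : 9 + 9 * t ^ 2 - 3 * t ^ 4 ≤ A ^ 2)
    (hσ : t * (r / 2 - t / 3) ≤ σ) (hσ1 : σ ≤ 1) :
    t ^ 2 * ((9 - σ ^ 2) * (3 - σ) ^ 3) < 4 * A ^ 2 * σ ^ 2 * (9 - σ) := by
  obtain ⟨u, hu⟩ : ∃ u : ℝ, u = r / 2 - t / 3 := ⟨_, rfl⟩
  rw [← hu] at hσ
  have hu1 : 65 / 100 ≤ u := by linarith
  have huu : u ^ 2 = 3 / 4 - 2 / 3 * (t * u) - t ^ 2 / 9 := by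
    rw [hu]
    linear_combination hr / 4
  obtain ⟨z, hz⟩ : ∃ z : ℝ, z = t * u := ⟨_, rfl⟩
  rw [← hz] at hσ huu
  have hz0 : 0 < z := by rw [hz]; positivity
  have h1 : (9 - σ ^ 2) * (3 - σ) ^ 3 ≤ (9 - z ^ 2) * (3 - z) ^ 3 := by
    have : 0 ≤ 9 - z ^ 2 := by nlinarith
    have h3σ : 0 ≤ 3 - σ := by linarith
    gcongr
  have h2 : z ^ 2 * (9 - z) ≤ σ ^ 2 * (9 - σ) := by
    have : 0 ≤ 9 * (σ + z) - (σ ^ 2 + σ * z + z ^ 2) := by nlinarith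
    nlinarith [mul_nonneg (sub_nonneg.2 hσ) this]
  have h3 : (9 - z ^ 2) * (3 - z) ^ 3 < 4 * (9 + 9 * t ^ 2 - 3 * t ^ 4) * u ^ 2 * (9 - z) := by
    have hz1 : z ≤ 1 := hσ.trans hσ1
    have ht2 : t ^ 2 ≤ 25 / 64 := by nlinarith
    have hq : 200 ≤ -30 - 18 * z + 9 * z ^ 2 - z ^ 3 + (36 - 12 * t ^ 2) * (9 - z) := by
      have : 0 ≤ (36 - 12 * t ^ 2 - 31) * (9 - z) := mul_nonneg (by linarith) (by linarith)
      have : 0 ≤ z ^ 2 * (9 - z) := mul_nonneg (sq_nonneg z) (by linarith)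
      linarith
    have hu4 : (65 / 100) ^ 2 ≤ u ^ 2 := by gcongr
    have hpos : 0 < t ^ 2 * (u ^ 2 *
        (-30 - 18 * z + 9 * z ^ 2 - z ^ 3 + (36 - 12 * t ^ 2) * (9 - z)) - 36 + 4 * z) := by
      have := mul_le_mul hu4 hq (by norm_num) (sq_nonneg u)
      exact mul_pos (by positivity) (by linarith)
    have hzz : z ^ 2 = t ^ 2 * u ^ 2 := by rw [hz]; ring
    have key : 4 * (9 + 9 * t ^ 2 - 3 * t ^ 4) * u ^ 2 * (9 - z) - (9 - z ^ 2) * (3 - z) ^ 3 =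
        t ^ 2 * (u ^ 2 *
          (-30 - 18 * z + 9 * z ^ 2 - z ^ 3 + (36 - 12 * t ^ 2) * (9 - z)) - 36 + 4 * z) := by
      linear_combination 36 * (9 - z) * huu + (-30 - 18 * z + 9 * z ^ 2 - z ^ 3) * hzz
    linarith
  have h4 : 0 ≤ z ^ 2 * (9 - z) := mul_nonneg (sq_nonneg z) (by linarith)
  calc t ^ 2 * ((9 - σ ^ 2) * (3 - σ) ^ 3) ≤ t ^ 2 * ((9 - z ^ 2) * (3 - z) ^ 3) := by gcongr
    _ < t ^ 2 * (4 * (9 + 9 * t ^ 2 - 3 * t ^ 4) * u ^ 2 * (9 - z)) := by gcongr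
    _ = 4 * (9 + 9 * t ^ 2 - 3 * t ^ 4) * (z ^ 2 * (9 - z)) := by rw [hz]; ring
    _ ≤ 4 * A ^ 2 * (z ^ 2 * (9 - z)) := by gcongr
    _ ≤ 4 * A ^ 2 * (σ ^ 2 * (9 - σ)) := by gcongr
    _ = 4 * A ^ 2 * σ ^ 2 * (9 - σ) := by ring

/-- The upper sign condition in the factored discriminant. -/
lemma sigma_upper {r t A σ : ℝ} (hr1 : 173 / 100 ≤ r)
    (ht0 : 0 < t) (ht : t ≤ 5 / 8)
    (hA : A ^ 2 ≤ 9 + 9 * t ^ 2)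
    (hσ : t * (r / 2 - t / 3) ≤ σ) (hσ1 : σ ≤ 1)
    (hD : σ ^ 2 ≤ t ^ 2 * (3 / 4 + 2 / 5 * t - 19 / 25 * t ^ 2)) :
    4 * A ^ 2 * σ ^ 2 * (9 + σ) < t ^ 2 * ((9 - σ ^ 2) * (3 + σ) ^ 3) := by
  have ht' : 0 ≤ 5 / 8 - t := by linarith
  have b (i j : ℕ) : 0 ≤ t ^ i * (5 / 8 - t) ^ j := by positivity
  have hσ' : t * (865 / 1000 - t / 3) ≤ σ := le_trans (mul_le_mul_of_nonneg_left (by linarith) ht0.le) hσ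
  have hσ0 : 0 < σ := lt_of_lt_of_le (mul_pos ht0 (by linarith)) hσ'
  have hd : 0 ≤ 3 / 4 + 32 / 100 * t - 3 / 5 * t ^ 2 := by nlinarith
  have h1 : 0 ≤ 243 - 36 * (1 + t ^ 2) * (3 / 4 + 2 / 5 * t - 19 / 25 * t ^ 2) := by
    linarith [b 0 4, b 1 3, b 2 2, b 3 1, b 4 0]
  have h2 : 0 < (865 / 1000 - t / 3) *
      (243 - 36 * (1 + t ^ 2) * (3 / 4 + 2 / 5 * t - 19 / 25 * t ^ 2))
      - 324 * (2 / 5 - 19 / 25 * t + t * (3 / 4 + 2 / 5 * t - 19 / 25 * t ^ 2)) := by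
    linarith [b 0 5, b 1 4, b 2 3, b 3 2, b 4 1, b 5 0]
  have h3 : 36 * (1 + t ^ 2) * (3 / 4 + 2 / 5 * t - 19 / 25 * t ^ 2) * (9 + σ)
      < 243 + 243 * σ := by
    nlinarith [mul_le_mul_of_nonneg_right hσ' h1, mul_pos ht0 h2]
  have h4 : 243 + 243 * σ ≤ (9 - σ ^ 2) * (3 + σ) ^ 3 := by
    have : 0 ≤ 54 - 18 * σ - 9 * σ ^ 2 - σ ^ 3 := by nlinarith [pow_le_one₀ hσ0.le hσ1 (n := 3)]
    nlinarith [mul_nonneg (sq_nonneg σ) this]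
  calc 4 * A ^ 2 * σ ^ 2 * (9 + σ)
      ≤ 4 * (9 + 9 * t ^ 2) * (t ^ 2 * (3 / 4 + 2 / 5 * t - 19 / 25 * t ^ 2)) * (9 + σ) := by
        gcongr
    _ = t ^ 2 * (36 * (1 + t ^ 2) * (3 / 4 + 2 / 5 * t - 19 / 25 * t ^ 2) * (9 + σ)) := by ring
    _ < t ^ 2 * ((9 - σ ^ 2) * (3 + σ) ^ 3) := by
        exact mul_lt_mul_of_pos_left (h3.trans_le h4) (by positivity)

/-- Transversality of the conic written in the normalized coordinates `(x, Y)`, `Y = y / ε`. -/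
lemma transversality_form_neg {A β C x Y : ℝ} (hA : 0 < A) (hβ : 0 < β) (hC : 0 < C)
    (hdisc : β * (A * C + 18 * β) ^ 2 < 36 * C * (2 * A * β ^ 2 + 9 * β - A * C))
    (hcurve : 9 * x ^ 2 - 6 * β * (x * Y) + C * Y ^ 2 = 9 * A) :
    x ^ 2 * (C / 3 - 2 * β ^ 2 / 3) + β * C / 9 * (x * Y) - 3 * β < 0 := by
  have hxy : x ≠ 0 ∨ Y ≠ 0 := by
    by_contra! h
    obtain ⟨rfl, rfl⟩ := h
    nlinarith
  have hq := quadratic_form_neg (α := 3 * A * C - 6 * A * β ^ 2 - 27 * β)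
    (β := β * (A * C + 18 * β)) (γ := -3 * β * C) (x := x) (y := Y)
    (by nlinarith [mul_pos hβ hC])
    (by nlinarith [mul_lt_mul_of_pos_left hdisc hβ]) hxy
  have h9 : 9 * A * (x ^ 2 * (C / 3 - 2 * β ^ 2 / 3) + β * C / 9 * (x * Y) - 3 * β) =
      (3 * A * C - 6 * A * β ^ 2 - 27 * β) * x ^ 2 + β * (A * C + 18 * β) * (x * Y)
        + -3 * β * C * Y ^ 2 := by
    linear_combination (3 * β) * hcurve
  rw [← h9] at hq
  exact neg_of_mul_neg_right hq (by positivity)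

/-- The discriminant inequality for every `β` in the range given by `beta_bounds`. -/
lemma discriminant_of_beta_bounds {r t β A C : ℝ} (hr : r ^ 2 = 3) (hr1 : 173 / 100 ≤ r)
    (hr2 : r ≤ 17321 / 10000) (ht0 : 0 < t) (ht : t ≤ 5 / 8)
    (hβ1 : 3 / 2 - 7 / 8 * t ^ 2 + r / 18 * t ^ 3
      + t ^ 4 * (425 / 1000 + t / 50 + 21 / 100 * t ^ 2) ≤ β)
    (hβ2 : β ≤ 3 / 2 - 7 / 8 * t ^ 2 + r / 18 * t ^ 3 + t ^ 4 * (44 / 100 + 24 / 100 * t ^ 2))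
    (hA : A = 3 + t ^ 2 * β) (hC : t ^ 2 * C = 9 - 2 * A * β + t ^ 2 * β ^ 2) :
    0 < β ∧ 0 < 9 - 2 * A * β ∧
      β * (A * C + 18 * β) ^ 2 < 36 * C * (2 * A * β ^ 2 + 9 * β - A * C) := by
  obtain ⟨hD1, hD2⟩ := conic_disc_bounds hr hr1 hr2 ht0 ht hβ1 hβ2
  rw [← hA] at hD1 hD2
  have ht2 : t ^ 2 ≤ 25 / 64 := by nlinarith
  have hL : 0 < t * (r / 2 - t / 3) := mul_pos ht0 (by linarith)
  have h3 : 0 ≤ t ^ 3 * (r / 18 - 9 / 100) := mul_nonneg (by positivity) (by linarith)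
  have h4 : 0 ≤ t ^ 5 / 50 + 21 / 100 * t ^ 6 := by positivity
  have hβ4 : 3 / 2 - 7 / 8 * t ^ 2 + 9 / 100 * t ^ 3 + 42 / 100 * t ^ 4 ≤ β := by
    linarith [pow_pos ht0 4]
  have h5 : 3 / 2 - 7 / 8 * t ^ 2 ≤ β := by linarith [pow_pos ht0 3, pow_pos ht0 4]
  have hβ0 : 1 ≤ β := by linarith
  have hD0 : 0 < 9 - 2 * A * β := (pow_pos hL 2).trans_le hD1
  have hβ3 : β ≤ 3 / 2 := by
    have : 0 ≤ t ^ 2 * β ^ 2 := by positivity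
    rw [hA] at hD0
    linarith
  have hσ2 := Real.sq_sqrt hD0.le
  have hσL : t * (r / 2 - t / 3) ≤ √(9 - 2 * A * β) := Real.le_sqrt_of_sq_le hD1
  have hσ1 : √(9 - 2 * A * β) ≤ 1 := by
    refine Real.sqrt_le_iff.2 ⟨by norm_num, hD2.trans ?_⟩
    have : 3 / 4 + 2 / 5 * t - 19 / 25 * t ^ 2 ≤ 1 := by linarith [sq_nonneg t]
    nlinarith [mul_le_mul_of_nonneg_left this (sq_nonneg t)]
  have hA1 : 9 + 9 * t ^ 2 - 3 * t ^ 4 ≤ A ^ 2 := by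
    have h6 : (3 / 2 - 7 / 8 * t ^ 2) ^ 2 ≤ β ^ 2 :=
      pow_le_pow_left₀ (by linarith) h5 2
    have h7 : 9 - 3 * t ^ 2 ≤ 6 * β + t ^ 2 * β ^ 2 := by
      have := mul_le_mul_of_nonneg_left h6 (sq_nonneg t)
      have h8 : 0 ≤ t ^ 3 * (54 / 100 - 105 / 1000 * t) :=
        mul_nonneg (by positivity) (by linarith)
      linarith [pow_pos ht0 6]
    have := mul_le_mul_of_nonneg_left h7 (sq_nonneg t)
    rw [hA]
    linarith
  have hA2 : A ^ 2 ≤ 9 + 9 * t ^ 2 := by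
    have h6 := mul_le_mul_of_nonneg_left (show A * β ≤ 9 / 2 by linarith) (sq_nonneg t)
    have h7 := mul_le_mul_of_nonneg_left hβ3 (sq_nonneg t)
    calc A ^ 2 = 9 + 3 * (t ^ 2 * β) + t ^ 2 * (A * β) := by rw [hA]; ring
      _ ≤ 9 + 9 * t ^ 2 := by linarith
  have hA0 : 0 < A := by
    rw [hA]
    positivity
  exact ⟨by linarith, hD0, discriminant_pos_of_sigma hA0 ht0 hσ2 (by rw [hσ2, hC])
    (sigma_lower hr hr1 ht0 ht hA1 hσL hσ1)
    (sigma_upper hr1 ht0 ht hA2 hσL hσ1 (hσ2.trans_le hD2))⟩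

/-- The analytic input on the semi-axis `a₀`. -/
lemma exterior_ellipse_estimates {ε a : ℝ} (hε : 8 / 5 ≤ ε)
    (ha : a = √3 + (√3 / 4) / ε ^ 2 - (17 / (32 * √3)) / ε ^ 4 + (1 / 36) / ε ^ 5
      + (1 / 5) / ε ^ 6) :
    ∃ β C : ℝ, 0 < a ∧ 0 < β ∧ a ^ 2 = 3 + β / ε ^ 2 ∧ 0 < 9 - 2 * a ^ 2 * β ∧
      C = ε ^ 2 * (9 - 2 * a ^ 2 * β) + β ^ 2 ∧
      β * (a ^ 2 * C + 18 * β) ^ 2 <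
        36 * C * (2 * a ^ 2 * β ^ 2 + 9 * β - a ^ 2 * C) := by
  have hε0 : 0 < ε := by linarith
  obtain ⟨t, rfl⟩ : ∃ t : ℝ, ε = 1 / t := ⟨1 / ε, by simp⟩
  have ht0 : 0 < t := one_div_pos.1 hε0
  have ht : t ≤ 5 / 8 := by
    rw [le_div_iff₀ ht0] at hε
    linarith
  have hr : √3 ^ 2 = (3 : ℝ) := Real.sq_sqrt (by norm_num)
  have hr1 : 173 / 100 ≤ √3 := Real.le_sqrt_of_sq_le (by norm_num)
  have hr2 : √3 ≤ 17321 / 10000 := Real.sqrt_le_iff.2 ⟨by norm_num, by norm_num⟩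
  have hinv : 17 / (32 * √3) = 17 / 96 * √3 := by
    rw [div_eq_iff (by positivity)]
    linear_combination (-17 / 3) * hr
  rw [hinv] at ha
  generalize √3 = r at *
  have ha' : a = r * (1 + t ^ 2 / 4 - 17 / 96 * t ^ 4) + t ^ 5 * (1 / 36 + t / 5) := by
    rw [ha]
    field_simp
    ring
  have ha0 : 0 < a := by
    rw [ha']
    have ht1 : t ^ 4 ≤ 1 := pow_le_one₀ ht0.le (by linarith)
    have : 0 < 1 + t ^ 2 / 4 - 17 / 96 * t ^ 4 := by linarith [sq_nonneg t]
    positivity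
  obtain ⟨β, hβ⟩ : ∃ β : ℝ, β = 3 / 2 - 7 / 8 * t ^ 2 - 17 / 64 * t ^ 4 + 289 / 3072 * t ^ 6
      + 2 * r * t ^ 3 * (1 / 36 + t / 5) * (1 + t ^ 2 / 4 - 17 / 96 * t ^ 4)
      + t ^ 8 * (1 / 36 + t / 5) ^ 2 := ⟨_, rfl⟩
  have hA : a ^ 2 = 3 + t ^ 2 * β := by
    rw [ha', hβ]
    linear_combination (1 + t ^ 2 / 4 - 17 / 96 * t ^ 4) ^ 2 * hr
  obtain ⟨hβ1, hβ2⟩ := beta_bounds hr1 hr2 ht0 ht hβ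
  obtain ⟨hβ0, hD0, hdisc⟩ := discriminant_of_beta_bounds (A := a ^ 2)
    (C := (1 / t) ^ 2 * (9 - 2 * a ^ 2 * β) + β ^ 2) hr hr1 hr2 ht0 ht hβ1 hβ2 hA
    (by field_simp)
  refine ⟨β, _, ha0, hβ0, ?_, hD0, rfl, hdisc⟩
  rw [hA]
  field_simp

/-- The exterior conic constructed by the paper's method for the van der Pol
system `ẋ = y - ε(x³/3 - x), ẏ = -x` is a nonempty bounded curve (an ellipse)
which is transversal: `ḟ` does not take both strictly positive and strictly
negative values on the curve, and vanishes at only finitely many of its points. -/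
theorem vanderPol_exterior_ellipse_transversal_11
    (ε a₀ : ℝ) (hε : 8 / 5 ≤ ε)
    (ha₀ : a₀ = Real.sqrt 3 + (Real.sqrt 3 / 4) / ε ^ 2 - (17 / (32 * Real.sqrt 3)) / ε ^ 4 + (1 / 36) / ε ^ 5 + (1 / 5) / ε ^ 6)
    (f fdot P Q : ℝ × ℝ → ℝ)
    (hf : ∀ x y : ℝ, f (x, y) =
      1 - x ^ 2 / a₀ ^ 2 - 2 * (3 - a₀ ^ 2) * ε * x * y / (3 * a₀ ^ 2)
        + (-9 - 9 * ε ^ 2 + a₀ ^ 4 * ε ^ 2) * y ^ 2 / (9 * a₀ ^ 2))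
    (hP : ∀ x y : ℝ, P (x, y) = y - ε * (x ^ 3 / 3 - x))
    (hQ : ∀ x y : ℝ, Q (x, y) = -x)
    (hfdot : ∀ p : ℝ × ℝ,
      fdot p = P p * fderiv ℝ f p (1, 0) + Q p * fderiv ℝ f p (0, 1)) :
    ({p : ℝ × ℝ | f p = 0}).Nonempty ∧
    Bornology.IsBounded {p : ℝ × ℝ | f p = 0} ∧
    ¬ ((∃ p : ℝ × ℝ, f p = 0 ∧ 0 < fdot p) ∧ (∃ p : ℝ × ℝ, f p = 0 ∧ fdot p < 0)) ∧
    Set.Finite {p : ℝ × ℝ | f p = 0 ∧ fdot p = 0} := by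
  obtain ⟨β, C, ha0, hβ, hA, hD, hC, hdisc⟩ := exterior_ellipse_estimates hε ha₀
  have hε0 : 0 < ε := by linarith
  have hC0 : 0 < C := by
    rw [hC]
    positivity
  clear ha₀
  have hβ' : (a₀ ^ 2 - 3) * ε ^ 2 = β := by
    rw [hA]
    field_simp
    ring
  have hcurve : ∀ x y : ℝ, f (x, y) = 0 →
      9 * x ^ 2 - 6 * β * (x * (y / ε)) + C * (y / ε) ^ 2 = 9 * a₀ ^ 2 := by
    intro x y h
    rw [hf] at h
    field_simp at h
    rw [hC, ← hβ']
    field_simp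
    linear_combination (-1 / 3) * h
  have hdot : ∀ x y : ℝ, f (x, y) = 0 → fdot (x, y) =
      -(2 * ε * (y / ε) ^ 2 / (9 * a₀ ^ 2)) *
        (x ^ 2 * (C / 3 - 2 * β ^ 2 / 3) + β * C / 9 * (x * (y / ε)) - 3 * β) := by
    intro x y h
    have hcv := hcurve x y h
    obtain ⟨h1, h2⟩ := fderiv_quadratic_form 1 (-1 / a₀ ^ 2)
      (-2 * (3 - a₀ ^ 2) * ε / (3 * a₀ ^ 2))
      ((-9 - 9 * ε ^ 2 + a₀ ^ 4 * ε ^ 2) / (9 * a₀ ^ 2)) f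
      (fun x y => by rw [hf]; ring) x y
    have hG : fdot (x, y) = -(2 * ε / (9 * a₀ ^ 2)) * (3 * x ^ 2 * (a₀ ^ 2 - x ^ 2)
        + β * x * (y / ε) * (a₀ ^ 2 + x ^ 2) - 3 * β * (y / ε) ^ 2) := by
      rw [hfdot, h1, h2, hP, hQ, ← hβ']
      field_simp
      ring
    rw [hG]
    linear_combination (2 * ε / (9 * a₀ ^ 2)) * (x ^ 2 / 3 + β * x * (y / ε) / 9) * hcv
  have hdot_nonneg : ∀ x y : ℝ, f (x, y) = 0 →
      0 ≤ fdot (x, y) ∧ (fdot (x, y) = 0 → y = 0) := by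
    intro x y h
    have hneg := transversality_form_neg (by positivity) hβ hC0 hdisc (hcurve x y h)
    rw [hdot x y h]
    refine ⟨by rw [neg_mul_comm]; exact mul_nonneg (by positivity) (by linarith), fun h0 => ?_⟩
    rcases mul_eq_zero.1 h0 with h0 | h0
    · by_contra hy
      have : 0 < 2 * ε * (y / ε) ^ 2 / (9 * a₀ ^ 2) := by positivity
      linarith
    · exact absurd h0 hneg.ne
  refine ⟨⟨(a₀, 0), ?_⟩, ?_, ?_, ?_⟩
  · simp only [Set.mem_ofPred_eq, hf]
    field_simp
    ring
  · obtain ⟨M, hM⟩ : ∃ M : ℝ, M = 9 * a₀ ^ 2 / (9 - 2 * a₀ ^ 2 * β) := ⟨_, rfl⟩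
    refine ((Metric.isBounded_Icc (-√(2 * a₀ ^ 2 + 2 * β ^ 2 / 9 * (M / ε ^ 2)))
      (√(2 * a₀ ^ 2 + 2 * β ^ 2 / 9 * (M / ε ^ 2)))).prod
      (Metric.isBounded_Icc (-√M) √M)).subset ?_
    rintro ⟨x, y⟩ h
    have hcv := hcurve x y h
    have hsq : (3 * x - β * (y / ε)) ^ 2 + y ^ 2 * (9 - 2 * a₀ ^ 2 * β) = 9 * a₀ ^ 2 := by
      have hy : y ^ 2 = ε ^ 2 * (y / ε) ^ 2 := by field_simp
      rw [hy, ← hcv, hC]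
      ring
    have hy : y ^ 2 ≤ M := by
      rw [hM, le_div_iff₀ hD]
      linarith [sq_nonneg (3 * x - β * (y / ε))]
    have hY : (y / ε) ^ 2 ≤ M / ε ^ 2 := by
      rw [div_pow]
      gcongr
    have hx : x ^ 2 ≤ 2 * a₀ ^ 2 + 2 * β ^ 2 / 9 * (M / ε ^ 2) := by
      have := mul_le_mul_of_nonneg_left hY (sq_nonneg β)
      linarith [sq_nonneg (3 * x - 2 * β * (y / ε)), mul_nonneg (sq_nonneg y) hD.le]
    exact ⟨abs_le.1 (Real.abs_le_sqrt hx), abs_le.1 (Real.abs_le_sqrt hy)⟩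
  · rintro ⟨-, ⟨x, y⟩, h, hlt⟩
    exact absurd hlt (not_lt.2 (hdot_nonneg x y h).1)
  · refine ((Set.finite_singleton ((a₀, 0) : ℝ × ℝ)).insert (-a₀, 0)).subset ?_
    rintro ⟨x, y⟩ ⟨h, h0⟩
    have hy := (hdot_nonneg x y h).2 h0
    subst hy
    have hx := hcurve x 0 h
    have hx' : x ^ 2 = a₀ ^ 2 := by
      simp only [zero_div, mul_zero] at hx
      linarith
    rcases sq_eq_sq_iff_eq_or_eq_neg.1 hx' with rfl | rfl <;> simp
end

section
/- Let ε ≥ 8/5 and let γ = (γ₁, γ₂) : ℝ → ℝ² be a nonconstant differentiable function with γ₁'(t) = γ₂(t) − ε(γ₁(t)³/3 − γ₁(t)), γ₂'(t) = −γ₁(t) for all t, and γ(t+T) = γ(t) for all t for some T > 0. Then every t with γ₂(t) = 0 and γ₁(t) > 0 satisfies √3 < γ₁(t) < √3 + (√3/4)·ε⁻² − (17/(32√3))·ε⁻⁴ + (1/36)·ε⁻⁵ + (1/5)·ε⁻⁶. In particular, the cut of the van der Pol limit cycle with the semiaxis {(x,0) : x > 0} belongs to this interval, whose length tends to 0 as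 ε → +∞. -/
/-- The disk `x² + y² ≤ 3` is backward invariant for the van der Pol flow. -/
lemma vanderPol_disk_backward_invariant {ε : ℝ} (hε : 0 ≤ ε) {x y : ℝ → ℝ}
    (hx : ∀ t, HasDerivAt x (y t - ε * ((x t) ^ 3 / 3 - x t)) t)
    (hy : ∀ t, HasDerivAt y (-(x t)) t) {s t : ℝ} (hst : s ≤ t)
    (ht : (x t) ^ 2 + (y t) ^ 2 ≤ 3) : (x s) ^ 2 + (y s) ^ 2 ≤ 3 := by
  have hxc : Continuous x := continuous_iff_continuousAt.2 fun t => (hx t).continuousAt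
  let E : ℝ → ℝ := fun t => ∫ u in (0 : ℝ)..t, 2 * ε / 3 * (x u) ^ 2
  have hE (t : ℝ) : HasDerivAt E (2 * ε / 3 * (x t) ^ 2) t :=
    Continuous.integral_hasStrictDerivAt (by fun_prop) 0 t |>.hasDerivAt
  have hmono : Monotone fun t => ((x t) ^ 2 + (y t) ^ 2 - 3) * Real.exp (E t) := by
    have hd (t : ℝ) : HasDerivAt (fun t => ((x t) ^ 2 + (y t) ^ 2 - 3) * Real.exp (E t))
        (2 * ε / 3 * (x t * y t) ^ 2 * Real.exp (E t)) t := by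
      refine HasDerivAt.congr_deriv
        (((((hx t).pow 2).add ((hy t).pow 2)).sub_const 3).mul (hE t).exp) ?_
      simp only [Pi.add_apply, Pi.pow_apply]
      push_cast
      ring
    refine monotone_of_deriv_nonneg (fun t => (hd t).differentiableAt) fun t => ?_
    rw [(hd t).deriv]
    positivity
  have h := hmono hst
  by_contra! hs
  have h1 : 0 < ((x s) ^ 2 + (y s) ^ 2 - 3) * Real.exp (E s) :=
    mul_pos (by linarith) (Real.exp_pos _)
  have h2 : ((x t) ^ 2 + (y t) ^ 2 - 3) * Real.exp (E t) ≤ 0 :=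
    mul_nonpos_of_nonpos_of_nonneg (by linarith) (Real.exp_pos _).le
  dsimp only at h
  linarith

/-- A periodic orbit of the van der Pol system crosses the positive `x`-semiaxis beyond `√3`. -/
lemma vanderPol_sqrt_three_lt {ε : ℝ} (hε : 0 < ε) {x y : ℝ → ℝ}
    (hx : ∀ t, HasDerivAt x (y t - ε * ((x t) ^ 3 / 3 - x t)) t)
    (hy : ∀ t, HasDerivAt y (-(x t)) t) {T : ℝ} (hT : 0 < T)
    (hper : ∀ t, x (t + T) = x t ∧ y (t + T) = y t) {t : ℝ}
    (hyt : y t = 0) (hxt : 0 < x t) : √3 < x t := by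
  rw [Real.sqrt_lt' hxt]
  by_contra! hle
  have hdisk {s : ℝ} (hs : s ≤ t) : (x s) ^ 2 + (y s) ^ 2 ≤ 3 :=
    vanderPol_disk_backward_invariant hε.le hx hy hs (by rw [hyt]; linarith)
  let g : ℝ → ℝ := fun s => (x s) ^ 2 + (y s) ^ 2
  have hg (s : ℝ) : HasDerivAt g (2 * ε / 3 * (x s) ^ 2 * (3 - (x s) ^ 2)) s := by
    refine HasDerivAt.congr_deriv (((hx s).pow 2).add ((hy s).pow 2)) ?_
    push_cast
    ring
  have hgmono : MonotoneOn g (Set.Icc (t - T) t) := by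
    refine monotoneOn_of_deriv_nonneg (convex_Icc _ _)
      (fun s _ => (hg s).continuousAt.continuousWithinAt)
      (fun s _ => (hg s).differentiableAt.differentiableWithinAt) fun s hs => ?_
    rw [interior_Icc] at hs
    rw [(hg s).deriv]
    have := hdisk hs.2.le
    have : 0 ≤ 3 - (x s) ^ 2 := by nlinarith [sq_nonneg (y s)]
    positivity
  have hgT : g (t - T) = g t := by
    have := hper (t - T)
    rw [sub_add_cancel] at this
    simp only [g, this]
  have hgconst {s : ℝ} (hs : s ∈ Set.Icc (t - T) t) : g s = g t :=
    le_antisymm (hgmono hs ⟨by linarith, le_rfl⟩ hs.2)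
      (hgT ▸ hgmono ⟨le_rfl, by linarith⟩ hs hs.1)
  have hxy {s : ℝ} (hs : s ∈ Set.Ioo (t - T) t) : x s * y s = 0 := by
    have hev : g =ᶠ[nhds s] fun _ => g t := by
      filter_upwards [Ioo_mem_nhds hs.1 hs.2] with u hu using hgconst (Set.Ioo_subset_Icc_self hu)
    have h0 := (hg s).unique ((hasDerivAt_const s (g t)).congr_of_eventuallyEq hev)
    rcases eq_or_ne (x s) 0 with h | h
    · rw [h, zero_mul]
    · have h3 : 3 - (x s) ^ 2 = 0 := by
        rcases mul_eq_zero.1 h0 with h' | h'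
        · exact absurd h' (by positivity)
        · exact h'
      have : y s = 0 := by
        have := hdisk hs.2.le
        exact pow_eq_zero_iff two_ne_zero |>.1 (le_antisymm (by linarith) (sq_nonneg _))
      rw [this, mul_zero]
  have hd : HasDerivWithinAt (fun s => x s * y s) (-(x t) ^ 2) (Set.Iio t) t := by
    refine HasDerivWithinAt.congr_deriv ((hx t).mul (hy t)).hasDerivWithinAt ?_
    rw [hyt]
    ring
  have hd0 : HasDerivWithinAt (fun s => x s * y s) 0 (Set.Iio t) t := by
    refine (hasDerivWithinAt_const t _ (0 : ℝ)).congr_of_eventuallyEq ?_ (by simp [hyt])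
    filter_upwards [Ioo_mem_nhdsLT (show t - T < t by linarith)] with s hs using hxy hs
  have := (uniqueDiffWithinAt_Iio t).eq_deriv _ hd hd0
  have : 0 < (x t) ^ 2 := by positivity
  linarith

/-- A periodic orbit of the van der Pol system satisfies `ẍ ≤ 0` wherever `x > 1` and `ẋ < 0`:
otherwise it would be trapped in backward time. -/
lemma vanderPol_second_deriv_nonpos {ε : ℝ} {x w : ℝ → ℝ}
    (hx : ∀ t, HasDerivAt x (w t) t)
    (hw : ∀ t, HasDerivAt w (-(ε * w t * ((x t) ^ 2 - 1) + x t)) t) {T : ℝ} (hT : 0 < T)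
    (hper : ∀ t, w (t + T) = w t) {t : ℝ}
    (hxt : 1 < x t) (hwt : w t < 0) : 0 ≤ ε * w t * ((x t) ^ 2 - 1) + x t := by
  by_contra! hneg
  let N : ℝ → ℝ := fun s => ε * w s * ((x s) ^ 2 - 1) + x s
  have hN (s : ℝ) : HasDerivAt N
      (-(ε * ((x s) ^ 2 - 1) * N s) + 2 * ε * x s * (w s) ^ 2 + w s) s := by
    refine HasDerivAt.congr_deriv
      ((((hw s).const_mul ε).mul (((hx s).pow 2).sub_const 1)).add (hx s)) ?_
    simp only [N, Pi.pow_apply]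
    push_cast
    ring
  have hNc : Continuous N := continuous_iff_continuousAt.2 fun s => (hN s).continuousAt
  obtain ⟨s₀, hs₀t, hs₀⟩ : ∃ s < t, 0 ≤ N s := by
    obtain ⟨s, hs, hs'⟩ := exists_hasDerivAt_eq_zero (show t - T < t by linarith)
      (fun s _ => (hw s).continuousAt.continuousWithinAt)
      (by have := hper (t - T); rw [sub_add_cancel] at this; exact this.symm)
      (fun s _ => hw s)
    exact ⟨s, hs.2, by simp only [N]; linarith⟩
  let S : Set ℝ := {s | 0 ≤ N s} ∩ Set.Icc s₀ t
  have hScpt : IsCompact S :=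
    isCompact_Icc.inter_left (isClosed_le continuous_const hNc)
  obtain ⟨τ, ⟨hτ, hτI⟩, hmax⟩ := hScpt.exists_isGreatest ⟨s₀, hs₀, le_rfl, hs₀t.le⟩
  have hτ0 : 0 ≤ N τ := hτ
  have hτt : τ < t := lt_of_le_of_ne hτI.2 fun h => by
    rw [h] at hτ0
    exact absurd hτ0 (not_le.2 hneg)
  have hlt {s : ℝ} (hs : s ∈ Set.Ioc τ t) : N s < 0 := by
    by_contra! h
    exact absurd (hmax ⟨h, hτI.1.trans hs.1.le, hs.2⟩) (not_le.2 hs.1)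
  have hwmono : MonotoneOn w (Set.Icc τ t) := by
    refine monotoneOn_of_deriv_nonneg (convex_Icc _ _)
      (fun s _ => (hw s).continuousAt.continuousWithinAt)
      (fun s _ => (hw s).differentiableAt.differentiableWithinAt) fun s hs => ?_
    rw [interior_Icc] at hs
    rw [(hw s).deriv]
    have : N s < 0 := hlt (Set.Ioo_subset_Ioc_self hs)
    simp only [N] at this
    linarith
  have hwneg {s : ℝ} (hs : s ∈ Set.Icc τ t) : w s < 0 :=
    (hwmono hs ⟨hτt.le, le_rfl⟩ hs.2).trans_lt hwt
  have hxanti : AntitoneOn x (Set.Icc τ t) := by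
    refine antitoneOn_of_deriv_nonpos (convex_Icc _ _)
      (fun s _ => (hx s).continuousAt.continuousWithinAt)
      (fun s _ => (hx s).differentiableAt.differentiableWithinAt) fun s hs => ?_
    rw [interior_Icc] at hs
    rw [(hx s).deriv]
    exact (hwneg (Set.Ioo_subset_Icc_self hs)).le
  have hxτ : 1 < x τ := hxt.trans_le (hxanti ⟨le_rfl, hτt.le⟩ ⟨hτt.le, le_rfl⟩ hτt.le)
  have hwτ : w τ < 0 := hwneg ⟨le_rfl, hτt.le⟩
  have hNτ : N τ = 0 := by
    refine le_antisymm ?_ hτ0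
    refine le_of_tendsto (hNc.continuousAt.continuousWithinAt (s := Set.Ioi τ)) ?_
    filter_upwards [Ioo_mem_nhdsGT hτt] with s hs using (hlt (Set.Ioo_subset_Ioc_self hs)).le
  have hpos : 0 < -(ε * ((x τ) ^ 2 - 1) * N τ) + 2 * ε * x τ * (w τ) ^ 2 + w τ := by
    have h1 : 0 < (x τ) ^ 2 - 1 := by nlinarith
    have h2 : (2 * ε * x τ * (w τ) ^ 2 + w τ) * ((x τ) ^ 2 - 1)
        = -w τ * ((x τ) ^ 2 + 1) + 2 * x τ * w τ * N τ := by
      simp only [N]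
      ring
    rw [hNτ, mul_zero, add_zero] at h2
    have h3 : 0 < -w τ * ((x τ) ^ 2 + 1) := mul_pos (by linarith) (by positivity)
    rw [← h2] at h3
    have h4 := pos_of_mul_pos_left h3 h1.le
    rw [hNτ]
    linarith
  have hslope : Filter.Tendsto (slope N τ) (nhdsWithin τ (Set.Ioi τ)) (nhds _) :=
    (hasDerivAt_iff_tendsto_slope.1 (hN τ)).mono_left
      (nhdsWithin_mono _ fun s hs => ne_of_gt hs)
  obtain ⟨s, hs, hsI⟩ :=
    ((hslope.eventually (lt_mem_nhds hpos)).and (Ioo_mem_nhdsGT hτt)).exists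
  rw [slope_def_field, hNτ, sub_zero] at hs
  have : N s / (s - τ) < 0 := div_neg_of_neg_of_pos (hlt (Set.Ioo_subset_Ioc_self hsI))
    (by linarith [hsI.1])
  linarith

/-- The upper end of the interval lies beyond the root of `(X² - 3)(X² - 1) = 3 ε⁻²`. -/
lemma vanderPol_bound_algebra {ε X : ℝ} (hε : 8 / 5 ≤ ε)
    (hX : √3 + (√3 / 4) / ε ^ 2 - (17 / (32 * √3)) / ε ^ 4 + (1 / 36) / ε ^ 5
      + (1 / 5) / ε ^ 6 ≤ X) : 3 / ε ^ 2 < (X ^ 2 - 3) * (X ^ 2 - 1) := by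
  have hε0 : 0 < ε := by linarith
  obtain ⟨e, he⟩ : ∃ e, e = 1 / ε ^ 2 := ⟨_, rfl⟩
  have he0 : 0 < e := by rw [he]; positivity
  have he1 : e ≤ 25 / 64 := by
    rw [he, div_le_div_iff₀ (by positivity) (by norm_num)]
    nlinarith
  have h3 : √3 ^ 2 = 3 := Real.sq_sqrt (by norm_num)
  have hs0 : 0 < √3 := by positivity
  have hs : √3 < 1.7321 := by
    rw [Real.sqrt_lt' (by norm_num)]
    norm_num
  let V : ℝ := 1 + e / 4 - 17 / 96 * e ^ 2 + 23 / 200 * e ^ 3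
  have hVX : √3 * V ≤ X := by
    have h17 : 17 / (32 * √3) = 17 / 96 * √3 := by
      field_simp
      rw [h3]
      norm_num
    have hU : √3 + (√3 / 4) / ε ^ 2 - (17 / (32 * √3)) / ε ^ 4 + (1 / 36) / ε ^ 5
        + (1 / 5) / ε ^ 6
        = √3 * (1 + e / 4 - 17 / 96 * e ^ 2) + e ^ 3 / 5 + (1 / 36) / ε ^ 5 := by
      rw [h17, he]
      ring
    have h5 : 0 < (1 / 36) / ε ^ 5 := by positivity
    have h6 : √3 * (23 / 200 * e ^ 3) ≤ e ^ 3 / 5 := by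
      nlinarith [pow_pos he0 3]
    simp only [V]
    nlinarith
  have hV1 : 1 ≤ V := by
    simp only [V]
    nlinarith [pow_pos he0 3]
  have hV : e < (V ^ 2 - 1) * (3 * V ^ 2 - 1) := by
    have h (n : ℕ) : e ^ n ≤ (25 / 64) ^ n := pow_le_pow_left₀ he0.le he1 n
    have hp (n : ℕ) : 0 < e ^ n := pow_pos he0 n
    have hQ : 0 < 1/6 - 1421/2400 * e + 98761/115200 * e ^ 2
        - 959/15360 * e ^ 3 - 1101361/5760000 * e ^ 4
        + 34351663/184320000 * e ^ 5 - 602065103/17694720000 * e ^ 6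
        - 96676567/9216000000 * e ^ 7
        + 6158089/512000000 * e ^ 8 - 206839/64000000 * e ^ 9 + 839523/1600000000 * e ^ 10 := by
      have hq := sq_nonneg (e - 69 / 200)
      have h3 := h 3
      have h4 := h 4
      have h6 := h 6
      have h7 := h 7
      have h9 := h 9
      norm_num at h3 h4 h6 h7 h9
      linarith [hp 5, hp 8, hp 10]
    have := mul_pos (hp 2) hQ
    simp only [V]
    linarith
  have hXV : 3 * V ^ 2 ≤ X ^ 2 := by
    have := pow_le_pow_left₀ (by positivity) hVX 2
    rwa [mul_pow, h3] at this
  have h3e : 3 / ε ^ 2 = 3 * e := by rw [he]; ring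
  have hV2 : 1 ≤ V ^ 2 := one_le_pow₀ hV1
  rw [h3e]
  nlinarith

/-- For `ε ≥ 8/5`, the cut of any nonconstant periodic orbit of the van der Pol
system `ẋ = y - ε(x³/3 - x), ẏ = -x` with the positive `x`-semiaxis lies in the
interval `(√3, √3 + (√3/4)ε⁻² - (17/(32√3))ε⁻⁴ + (1/36)ε⁻⁵ + (1/5)ε⁻⁶)`. -/
theorem vanderPol_limit_cycle_cut
    (ε : ℝ) (hε : 8 / 5 ≤ ε)
    (γ₁ γ₂ : ℝ → ℝ)
    (h1 : ∀ t : ℝ, HasDerivAt γ₁ (γ₂ t - ε * ((γ₁ t) ^ 3 / 3 - γ₁ t)) t)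
    (h2 : ∀ t : ℝ, HasDerivAt γ₂ (-(γ₁ t)) t)
    (T : ℝ) (hT : 0 < T)
    (hper : ∀ t : ℝ, γ₁ (t + T) = γ₁ t ∧ γ₂ (t + T) = γ₂ t)
    (hnc : ∃ t₁ t₂ : ℝ, (γ₁ t₁, γ₂ t₁) ≠ (γ₁ t₂, γ₂ t₂)) :
    ∀ t : ℝ, γ₂ t = 0 → 0 < γ₁ t →
      Real.sqrt 3 < γ₁ t ∧
      γ₁ t < Real.sqrt 3 + (Real.sqrt 3 / 4) / ε ^ 2
        - (17 / (32 * Real.sqrt 3)) / ε ^ 4 + (1 / 36) / ε ^ 5 + (1 / 5) / ε ^ 6 := by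
  intro t hyt hxt
  have hε0 : 0 < ε := by linarith
  have hlow := vanderPol_sqrt_three_lt hε0 h1 h2 hT hper hyt hxt
  refine ⟨hlow, ?_⟩
  by_contra! hX
  have hx3 : 3 < (γ₁ t) ^ 2 := (Real.sqrt_lt' hxt).1 hlow
  have hw (s : ℝ) : HasDerivAt (fun s => γ₂ s - ε * ((γ₁ s) ^ 3 / 3 - γ₁ s))
      (-(ε * (γ₂ s - ε * ((γ₁ s) ^ 3 / 3 - γ₁ s)) * ((γ₁ s) ^ 2 - 1) + γ₁ s)) s := by
    refine HasDerivAt.congr_deriv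
      ((h2 s).sub (((((h1 s).pow 3).div_const 3).sub (h1 s)).const_mul ε)) ?_
    push_cast
    ring
  have hwt : γ₂ t - ε * ((γ₁ t) ^ 3 / 3 - γ₁ t) < 0 := by
    rw [hyt]
    have : 0 < ε * (γ₁ t * ((γ₁ t) ^ 2 - 3)) :=
      mul_pos hε0 (mul_pos hxt (by linarith))
    nlinarith
  have hN := vanderPol_second_deriv_nonpos h1 hw hT
    (fun s => by simp only [hper s]) (by nlinarith) hwt
  have halg := vanderPol_bound_algebra hε hX
  rw [div_lt_iff₀ (by positivity)] at halg
  rw [hyt] at hN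
  nlinarith [mul_lt_mul_of_pos_left halg hxt]
end

section
/- Let δ = −1 and let a₀ be either 159/125 or 646747/500000. Define f(x,y) = 1 − x²/a₀² + 2(−a₀² + a₀⁴ + δ)xy/a₀² + (−1 + a₀⁴ − 4a₀⁶ + 3a₀⁸ + 2a₀⁴δ − δ²)y²/a₀². With P(x,y) = y − (x⁵ − x³ + δx), Q(x,y) = −x, and ḟ = P·∂f/∂x + Q·∂f/∂y, the set C = {(x,y) ∈ ℝ² : f(x,y) = 0} is nonempty and bounded (an ellipse), ḟ does not take both strictly positive and strictly negative values on C, and {p ∈ C : ḟ(p) = 0} is finite. -/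
/-- The binary quartic form with coefficients `c₀, …, c₄`, where `c₃ = 2 c₄ α`, is positive as soon as
completing the square with parameter `b` leaves a positive definite quadratic remainder. -/
lemma quartic_form_pos {c₀ c₁ c₂ c₃ c₄ α b : ℝ} (h₄ : 0 < c₄) (hα : c₃ = 2 * c₄ * α)
    (hA : 0 < c₂ - c₄ * (α ^ 2 + 2 * b))
    (hdisc : (c₁ - 2 * c₄ * α * b) ^ 2 <
      4 * (c₂ - c₄ * (α ^ 2 + 2 * b)) * (c₀ - c₄ * b ^ 2))
    {x y : ℝ} (hy : y ≠ 0) :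
    0 < c₀ * x ^ 4 + c₁ * x ^ 3 * y + c₂ * x ^ 2 * y ^ 2 + c₃ * x * y ^ 3 + c₄ * y ^ 4 := by
  rcases eq_or_ne x 0 with rfl | hx
  · have : 0 < c₄ * y ^ 4 := by positivity
    simpa using this
  · set A := c₂ - c₄ * (α ^ 2 + 2 * b) with hAdef
    set B := c₁ - 2 * c₄ * α * b with hBdef
    set C := c₀ - c₄ * b ^ 2 with hCdef
    have hpos : 0 < 4 * A * C - B ^ 2 := sub_pos.mpr hdisc
    have key : 4 * A * (c₀ * x ^ 4 + c₁ * x ^ 3 * y + c₂ * x ^ 2 * y ^ 2 + c₃ * x * y ^ 3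
        + c₄ * y ^ 4) = 4 * A * c₄ * (y ^ 2 + α * x * y + b * x ^ 2) ^ 2
          + x ^ 2 * ((2 * A * y + B * x) ^ 2 + (4 * A * C - B ^ 2) * x ^ 2) := by
      rw [hα, hCdef, hBdef]
      linear_combination (-4 * A * x ^ 2 * y ^ 2) * hAdef
    have : 0 < 4 * A * (c₀ * x ^ 4 + c₁ * x ^ 3 * y + c₂ * x ^ 2 * y ^ 2 + c₃ * x * y ^ 3
        + c₄ * y ^ 4) := by
      rw [key]
      positivity
    exact (pos_iff_pos_of_mul_pos this).mp (by positivity)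

/-- On the ellipse `x² - 2Bxy - Cy² = a²`, with `B` and `C` chosen to cancel `x⁶` and `x⁵y`, the derivative
along the Rychkov field with `δ = -1` becomes `y²` times a binary quartic form. -/
lemma rychkov_derivative_on_ellipse {a B C x y : ℝ}
    (hB : 1 + B = a ^ 4 - a ^ 2)
    (hC : 4 * B * (1 + B) + (B - 1 - C) + 3 * a ^ 2 * B - a ^ 4 * B = 0)
    (hq : x ^ 2 - 2 * B * x * y - C * y ^ 2 = a ^ 2) :
    a ^ 4 * ((y - (x ^ 5 - x ^ 3 - x)) * (B * y - x) - x * (B * x + C * y)) =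
      y ^ 2 * ((-(1 + B) * (4 * B ^ 2 - 2 * C) - 4 * B * (B - 1 - C) + B
            + a ^ 2 * (C - 2 * B ^ 2)) * x ^ 4
        + (-(1 + B) * (4 * B * C) + (B - 1 - C) * (4 * B ^ 2 - 2 * C) - 4 * B ^ 2
            - a ^ 2 * B * C) * x ^ 3 * y
        + (-(1 + B) * C ^ 2 + (B - 1 - C) * (4 * B * C) + B * (4 * B ^ 2 - 2 * C))
            * x ^ 2 * y ^ 2
        + ((B - 1 - C) * C ^ 2 + 4 * B ^ 2 * C) * x * y ^ 3
        + B * C ^ 2 * y ^ 4) := by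
  linear_combination
    (-((-(1 + B) * x ^ 2 + (B - 1 - C) * x * y + B * y ^ 2)
        * (a ^ 2 + (x ^ 2 - 2 * B * x * y - C * y ^ 2)) + a ^ 2 * x ^ 3 * (B * y - x))) * hq
      - x ^ 6 * hB + x ^ 5 * y * hC

lemma isBounded_ellipse {a B C : ℝ} (hD : 0 < -C - B ^ 2) :
    Bornology.IsBounded {p : ℝ × ℝ | p.1 ^ 2 - 2 * B * p.1 * p.2 - C * p.2 ^ 2 = a ^ 2} := by
  obtain ⟨R, hR⟩ : ∃ R, R = a ^ 2 / (-C - B ^ 2) := ⟨_, rfl⟩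
  obtain ⟨S, hS⟩ : ∃ S, S = 2 * (a ^ 2 + B ^ 2 * R) := ⟨_, rfl⟩
  refine (Metric.isBounded_Icc (-(S + 1), -(R + 1)) (S + 1, R + 1)).subset ?_
  rintro ⟨x, y⟩ h
  change x ^ 2 - 2 * B * x * y - C * y ^ 2 = a ^ 2 at h
  have hy : y ^ 2 ≤ R := by
    rw [hR, le_div_iff₀ hD]
    nlinarith [sq_nonneg (x - B * y)]
  have hu : (x - B * y) ^ 2 ≤ a ^ 2 := by
    nlinarith [mul_nonneg hD.le (sq_nonneg y)]
  have hx : x ^ 2 ≤ S := by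
    rw [hS]
    nlinarith [sq_nonneg (x - 2 * (B * y)), mul_le_mul_of_nonneg_left hy (sq_nonneg B)]
  refine ⟨⟨?_, ?_⟩, ⟨?_, ?_⟩⟩ <;> dsimp only <;> nlinarith [sq_nonneg (x - 1), sq_nonneg (x + 1),
    sq_nonneg (y - 1), sq_nonneg (y + 1)]

lemma hasFDerivAt_conic (A B C : ℝ) (p : ℝ × ℝ) :
    HasFDerivAt (fun p : ℝ × ℝ => 1 + A * p.1 ^ 2 + B * (p.1 * p.2) + C * p.2 ^ 2)
      ((2 * A * p.1 + B * p.2) • ContinuousLinearMap.fst ℝ ℝ ℝ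
        + (B * p.1 + 2 * C * p.2) • ContinuousLinearMap.snd ℝ ℝ ℝ) p := by
  have h₁ : HasFDerivAt (fun p : ℝ × ℝ => p.1) (ContinuousLinearMap.fst ℝ ℝ ℝ) p := hasFDerivAt_fst
  have h₂ : HasFDerivAt (fun p : ℝ × ℝ => p.2) (ContinuousLinearMap.snd ℝ ℝ ℝ) p := hasFDerivAt_snd
  refine (((((h₁.pow 2).const_mul A).const_add 1).add ((h₁.mul h₂).const_mul B)).add
    ((h₂.pow 2).const_mul C)).congr_fderiv ?_
  ext <;> simp <;> ring

/-- The two values of `a₀` give ellipses on which the quartic form governing `ḟ` is definite,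
negative for the first and positive for the second. -/
lemma rychkov_quartic_definite {a B C : ℝ}
    (ha : a = 159 / 125 ∨ a = 646747 / 500000) (hB : B = -a ^ 2 + a ^ 4 - 1)
    (hC : C = -2 - a ^ 4 - 4 * a ^ 6 + 3 * a ^ 8) :
    ∃ ε : ℝ, ∀ x y : ℝ, y ≠ 0 →
      0 < ε * ((-(1 + B) * (4 * B ^ 2 - 2 * C) - 4 * B * (B - 1 - C) + B
            + a ^ 2 * (C - 2 * B ^ 2)) * x ^ 4
        + (-(1 + B) * (4 * B * C) + (B - 1 - C) * (4 * B ^ 2 - 2 * C) - 4 * B ^ 2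
            - a ^ 2 * B * C) * x ^ 3 * y
        + (-(1 + B) * C ^ 2 + (B - 1 - C) * (4 * B * C) + B * (4 * B ^ 2 - 2 * C))
            * x ^ 2 * y ^ 2
        + ((B - 1 - C) * C ^ 2 + 4 * B ^ 2 * C) * x * y ^ 3
        + B * C ^ 2 * y ^ 4) := by
  have hα : 2 * (B * C ^ 2) * (((B - 1 - C) * C + 4 * B ^ 2) / (2 * (B * C)))
      = (B - 1 - C) * C ^ 2 + 4 * B ^ 2 * C := by
    have : B ≠ 0 := by rcases ha with rfl | rfl <;> norm_num [hB]
    have : C ≠ 0 := by rcases ha with rfl | rfl <;> norm_num [hC]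
    field_simp
  rcases ha with rfl | rfl
  · refine ⟨-1, fun x y hy => ?_⟩
    refine (quartic_form_pos (c₀ := -(-(1 + B) * (4 * B ^ 2 - 2 * C) - 4 * B * (B - 1 - C) + B
            + (159 / 125) ^ 2 * (C - 2 * B ^ 2)))
        (c₁ := -(-(1 + B) * (4 * B * C) + (B - 1 - C) * (4 * B ^ 2 - 2 * C) - 4 * B ^ 2
            - (159 / 125) ^ 2 * B * C))
        (c₂ := -(-(1 + B) * C ^ 2 + (B - 1 - C) * (4 * B * C) + B * (4 * B ^ 2 - 2 * C)))
        (c₃ := -((B - 1 - C) * C ^ 2 + 4 * B ^ 2 * C)) (c₄ := -(B * C ^ 2))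
        (α := ((B - 1 - C) * C + 4 * B ^ 2) / (2 * (B * C))) (b := 0)
        ?_ (by linear_combination hα) ?_ ?_ (x := x) hy).trans_eq (by ring)
    all_goals
      norm_num at hB hC
      rw [hB, hC]
      norm_num
  · refine ⟨1, fun x y hy => ?_⟩
    rw [one_mul]
    refine quartic_form_pos (α := ((B - 1 - C) * C + 4 * B ^ 2) / (2 * (B * C))) (b := 447 / 10)
      ?_ hα.symm ?_ ?_ hy
    all_goals
      norm_num at hB hC
      rw [hB, hC]
      norm_num


/-- For the Rychkov system `ẋ = y - (x⁵ - x³ + δx), ẏ = -x` with `δ = -1`, the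
conics obtained for `a₀ = 159/125` and `a₀ = 646747/500000` are nonempty bounded
curves (ellipses) which are transversal: `ḟ` does not take both strictly positive
and strictly negative values on the curve, and vanishes at only finitely many of
its points. -/
theorem rychkov_ellipses_transversal
    (δ a₀ : ℝ) (hδ : δ = -1)
    (ha₀ : a₀ = 159 / 125 ∨ a₀ = 646747 / 500000)
    (f fdot P Q : ℝ × ℝ → ℝ)
    (hf : ∀ x y : ℝ, f (x, y) =
      1 - x ^ 2 / a₀ ^ 2 + 2 * (-a₀ ^ 2 + a₀ ^ 4 + δ) * x * y / a₀ ^ 2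
        + (-1 + a₀ ^ 4 - 4 * a₀ ^ 6 + 3 * a₀ ^ 8 + 2 * a₀ ^ 4 * δ - δ ^ 2) * y ^ 2
            / a₀ ^ 2)
    (hP : ∀ x y : ℝ, P (x, y) = y - (x ^ 5 - x ^ 3 + δ * x))
    (hQ : ∀ x y : ℝ, Q (x, y) = -x)
    (hfdot : ∀ p : ℝ × ℝ,
      fdot p = P p * fderiv ℝ f p (1, 0) + Q p * fderiv ℝ f p (0, 1)) :
    ({p : ℝ × ℝ | f p = 0}).Nonempty ∧
    Bornology.IsBounded {p : ℝ × ℝ | f p = 0} ∧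
    ¬ ((∃ p : ℝ × ℝ, f p = 0 ∧ 0 < fdot p) ∧ (∃ p : ℝ × ℝ, f p = 0 ∧ fdot p < 0)) ∧
    Set.Finite {p : ℝ × ℝ | f p = 0 ∧ fdot p = 0} := by
  subst hδ
  have ha : 0 < a₀ := by rcases ha₀ with rfl | rfl <;> norm_num
  obtain ⟨B, hB⟩ : ∃ B, B = -a₀ ^ 2 + a₀ ^ 4 - 1 := ⟨_, rfl⟩
  obtain ⟨C, hC⟩ : ∃ C, C = -2 - a₀ ^ 4 - 4 * a₀ ^ 6 + 3 * a₀ ^ 8 := ⟨_, rfl⟩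
  have hD : 0 < -C - B ^ 2 := by
    rw [hB, hC]
    rcases ha₀ with rfl | rfl <;> norm_num
  have hfun : f = fun p : ℝ × ℝ => 1 + -1 / a₀ ^ 2 * p.1 ^ 2 + 2 * B / a₀ ^ 2 * (p.1 * p.2)
      + C / a₀ ^ 2 * p.2 ^ 2 := by
    ext ⟨x, y⟩
    rw [hf, hB, hC]
    ring
  have hcurve (x y : ℝ) : f (x, y) = 0 ↔ x ^ 2 - 2 * B * x * y - C * y ^ 2 = a₀ ^ 2 := by
    have : f (x, y) = (a₀ ^ 2 - (x ^ 2 - 2 * B * x * y - C * y ^ 2)) / a₀ ^ 2 := by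
      rw [hfun]
      field_simp
      ring
    rw [this, div_eq_zero_iff, or_iff_left (by positivity), sub_eq_zero, eq_comm]
  have hdot (x y : ℝ) : a₀ ^ 2 * fdot (x, y) =
      2 * ((y - (x ^ 5 - x ^ 3 - x)) * (B * y - x) - x * (B * x + C * y)) := by
    rw [hfdot, hP, hQ, hfun, (hasFDerivAt_conic _ _ _ _).fderiv]
    simp only [add_apply, smul_apply, ContinuousLinearMap.coe_fst',
      ContinuousLinearMap.coe_snd', smul_eq_mul]
    field_simp
    ring
  obtain ⟨ε, hε⟩ := rychkov_quartic_definite ha₀ hB hC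
  have hsign {x y : ℝ} (h : f (x, y) = 0) (hy : y ≠ 0) : 0 < ε * fdot (x, y) := by
    have hG := rychkov_derivative_on_ellipse (by rw [hB]; ring) (by rw [hB, hC]; ring)
      ((hcurve x y).mp h)
    have hpos := mul_pos (show 0 < 2 * y ^ 2 by positivity) (hε x y hy)
    refine pos_of_mul_pos_right (a := a₀ ^ 6) (hpos.trans_eq ?_) (by positivity)
    linear_combination (-2 * ε) * hG - ε * a₀ ^ 4 * hdot x y
  have hzero {x : ℝ} (h : f (x, 0) = 0) : fdot (x, 0) = 0 := by
    have hG := rychkov_derivative_on_ellipse (by rw [hB]; ring) (by rw [hB, hC]; ring)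
      ((hcurve x 0).mp h)
    have : a₀ ^ 6 * fdot (x, 0) = 0 := by
      linear_combination 2 * hG + a₀ ^ 4 * hdot x 0
    exact (mul_eq_zero.mp this).resolve_left (by positivity)
  refine ⟨⟨(a₀, 0), (hcurve a₀ 0).mpr (by ring)⟩, ?_, ?_, ?_⟩
  · refine (isBounded_ellipse (a := a₀) hD).subset ?_
    rintro ⟨x, y⟩ h
    exact (hcurve x y).mp h
  · rintro ⟨⟨⟨x, y⟩, h, hpos⟩, ⟨⟨x', y'⟩, h', hneg⟩⟩
    have hy : y ≠ 0 := by
      rintro rfl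
      exact hpos.ne' (hzero h)
    have hy' : y' ≠ 0 := by
      rintro rfl
      exact hneg.ne (hzero h')
    have hε₁ : 0 < ε := pos_of_mul_pos_left (hsign h hy) hpos.le
    exact (mul_neg_of_pos_of_neg hε₁ hneg).not_gt (hsign h' hy')
  · refine (Set.toFinite {(a₀, 0), (-a₀, 0)}).subset ?_
    rintro ⟨x, y⟩ ⟨h, h₀⟩
    obtain rfl : y = 0 := by
      by_contra hy
      simpa [h₀] using hsign h hy
    have hx : x ^ 2 = a₀ ^ 2 := by simpa using (hcurve x 0).mp h
    rcases sq_eq_sq_iff_eq_or_eq_neg.mp hx with rfl | rfl <;> simp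
end

section
/- Set δᵢ = −3·(−9 + 6√3)^{1/3}/4^{1/3} (≈ −2.1103). For every δ with δᵢ < δ < 0, the polynomial b⁶ − 4b³ − δb² + 1 has a real root b₀ > 0. -/
/-- The nonnegative real cube root, as a real power, cubes back to its argument. -/
lemma rpow_one_third_pow_three {x : ℝ} (hx : 0 ≤ x) : (x ^ ((1 : ℝ) / 3)) ^ 3 = x := by
  rw [← Real.rpow_natCast, ← Real.rpow_mul hx]
  norm_num

/-- Set `δᵢ = -3·(-9 + 6√3)^(1/3) / 4^(1/3)`. For every `δ ∈ (δᵢ, 0)`, the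
polynomial `b⁶ - 4b³ - δb² + 1` has a real root `b₀ > 0`. -/
theorem exists_positive_root
    (δ : ℝ)
    (hl : -3 * (-9 + 6 * Real.sqrt 3) ^ ((1 : ℝ) / 3) / (4 : ℝ) ^ ((1 : ℝ) / 3) < δ)
    (hr : δ < 0) :
    ∃ b₀ : ℝ, 0 < b₀ ∧ b₀ ^ 6 - 4 * b₀ ^ 3 - δ * b₀ ^ 2 + 1 = 0 := by
  have hs : Real.sqrt 3 ^ 2 = 3 := Real.sq_sqrt (by norm_num)
  have hs0 : 0 ≤ Real.sqrt 3 := Real.sqrt_nonneg 3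
  set s := Real.sqrt 3
  have hA : 0 ≤ -9 + 6 * s := by nlinarith
  set c := (-9 + 6 * s) ^ ((1 : ℝ) / 3) / (4 : ℝ) ^ ((1 : ℝ) / 3) with hc
  have hc0 : 0 ≤ c := by positivity
  have hc3 : c ^ 3 = (-9 + 6 * s) / 4 := by
    rw [hc, div_pow, rpow_one_third_pow_three hA, rpow_one_third_pow_three (by norm_num)]
  have hδ : -3 * c < δ := by rwa [hc, ← mul_div_assoc]
  -- `b` minimises `b⁴ - 4b + b⁻²` over the positive reals.
  set b := ((1 + s) / 2) ^ ((1 : ℝ) / 3)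
  have hb0 : 0 < b := by positivity
  have hb3 : b ^ 3 = (1 + s) / 2 := rpow_one_third_pow_three (by positivity)
  have hbc : b ^ 2 * c = s / 2 := by
    have h : (b ^ 2 * c) ^ 3 = (s / 2) ^ 3 := by
      calc (b ^ 2 * c) ^ 3 = (b ^ 3) ^ 2 * c ^ 3 := by ring
        _ = (s / 2) ^ 3 := by
          rw [hb3, hc3]
          linear_combination (1 / 4 * s + 3 / 16) * hs
    exact (pow_left_inj₀ (by positivity) (by positivity) (by norm_num)).mp h
  have hneg : b ^ 6 - 4 * b ^ 3 - δ * b ^ 2 + 1 ≤ 0 := by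
    have h6 : b ^ 6 = ((1 + s) / 2) ^ 2 := by rw [← hb3]; ring
    rw [h6, hb3]
    nlinarith [mul_pos (sub_pos.mpr hδ) (pow_pos hb0 2)]
  obtain ⟨x, ⟨hx0, -⟩, hx⟩ := intermediate_value_Icc' hb0.le
    (f := fun x : ℝ => x ^ 6 - 4 * x ^ 3 - δ * x ^ 2 + 1) (by fun_prop)
    (show (0 : ℝ) ∈ _ from ⟨hneg, by norm_num⟩)
  refine ⟨x, hx0.lt_of_ne ?_, hx⟩
  rintro rfl
  norm_num at hx
end
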